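/- arXiv:1703.10790 — 2 statements merged into one kernel-verified Lean document; each statement's English description precedes it below -/
import Mathlib

section
/- Let d ≥ 1, let 0 ≤ β ≤ 1, and let ν be a Lévy measure on ℝ^d with ∫_{‖x‖<1} ‖x‖^β ν(dx) < ∞. Let (p_t)_{t≥0} be the marginal laws of the Lévy process with characteristic exponent ψ(ξ) = ∫ (1 − e^{i⟨ξ,y⟩}) ν(dy) (i.e. triplet (0, γ, ν) with drift γ₀ = ∫_{‖y‖≤1} y ν(dy) − γ = 0). Let g be a bounded Borel function and μ a finite Borel measure on ℝ^d, and assume that r = g ∗ μ̌ is bounded and continuous and satisfies |r(x) − r(0)| ≤ C‖x‖^β for all ‖x‖ < 1 and some constant C > 0. Then lim_{t→0+} t^{−1}(H_g^μ(t) − H_g^μ(0)) = ∫_{ℝ^d} (r(x) − r(0)) ν(dx), the integral on the right being absolutely convergent. -/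
open MeasureTheory Filter
open scoped Topology RealInnerProductSpace ENNReal

theorem norm_one_sub_exp_neg_le {z : ℂ} (hz : 0 ≤ z.re) : ‖1 - Complex.exp (-z)‖ ≤ ‖z‖ := by
  have h := (convex_halfSpace_re_le 0).norm_image_sub_le_of_norm_hasDerivWithin_le
    (f := Complex.exp) (f' := Complex.exp) (C := 1) (x := -z) (y := 0)
    (fun x _ => (Complex.hasDerivAt_exp x).hasDerivWithinAt)
    (fun x hx => by rw [Complex.norm_exp]; exact Real.exp_le_one_iff.2 hx)
    (by simpa using hz) (by simp)
  simpa using h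

theorem tendsto_inv_mul_one_sub_exp (z : ℂ) {t : ℕ → ℝ} (ht : ∀ n, 0 < t n)
    (ht0 : Tendsto t atTop (𝓝 0)) :
    Tendsto (fun n => (t n)⁻¹ • (1 - Complex.exp (-(t n : ℂ) * z))) atTop (𝓝 z) := by
  have hd : HasDerivAt (fun s : ℝ => 1 - Complex.exp (-(s : ℂ) * z)) z 0 := by
    have := ((((hasDerivAt_id (0 : ℝ)).ofReal_comp).neg.mul_const z).cexp).const_sub 1
    simpa using this
  have := hd.tendsto_slope.comp
    (tendsto_nhdsWithin_iff.2 ⟨ht0, Eventually.of_forall fun n => (ht n).ne'⟩)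
  simpa [Function.comp_def, slope_def_module] using this

section MinNorm

variable {E : Type*} [NormedAddCommGroup E] [MeasurableSpace E] {ν : Measure E}

theorem sigmaFinite_of_integrable_min_norm (hν0 : ν {0} = 0)
    (hν : Integrable (fun y : E => min 1 ‖y‖) ν) : SigmaFinite ν := by
  obtain ⟨t, ht, hzero, hσ⟩ := hν.aefinStronglyMeasurable.exists_set_sigmaFinite
  have htc : ν tᶜ = 0 := by
    have h1 : ∀ᵐ y ∂ν, y ∈ tᶜ → min 1 ‖y‖ = 0 := (ae_restrict_iff' ht.compl).1 hzero
    have h2 : ∀ᵐ y ∂ν, y ≠ (0 : E) := by simpa [ae_iff] using hν0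
    refine measure_mono_null (t := {y | ¬ (y ∉ tᶜ)}) (by intro y hy; simpa using hy) ?_
    rw [← ae_iff]
    filter_upwards [h1, h2] with y hy1 hy2 hy3
    have : 0 < min 1 ‖y‖ := lt_min one_pos (norm_pos_iff.2 hy2)
    exact this.ne' (hy1 hy3)
  rwa [Measure.restrict_eq_self_of_ae_mem (ae_iff.2 htc)] at hσ

end MinNorm

section LevySymbol

variable {E : Type*} [NormedAddCommGroup E] [InnerProductSpace ℝ E]

/-- The integrand `1 - e^{i⟨ξ, y⟩}` of the Lévy–Khintchine formula without compensation. -/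
noncomputable def oneSubChar (ξ y : E) : ℂ := 1 - Complex.exp (Complex.I * (⟪ξ, y⟫ : ℂ))

theorem oneSubChar_zero_right (ξ : E) : oneSubChar ξ 0 = 0 := by simp [oneSubChar]

theorem continuous_oneSubChar : Continuous (fun z : E × E => oneSubChar z.1 z.2) := by
  unfold oneSubChar; fun_prop

theorem norm_oneSubChar_le_two (ξ y : E) : ‖oneSubChar ξ y‖ ≤ 2 := by
  calc ‖oneSubChar ξ y‖ ≤ ‖(1 : ℂ)‖ + ‖Complex.exp (Complex.I * (⟪ξ, y⟫ : ℂ))‖ := norm_sub_le _ _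
    _ = 2 := by rw [Complex.norm_exp_I_mul_ofReal]; norm_num

theorem norm_oneSubChar_le (ξ y : E) : ‖oneSubChar ξ y‖ ≤ (2 + ‖ξ‖) * min 1 ‖y‖ := by
  rcases le_total 1 ‖y‖ with h | h
  · rw [min_eq_left h]
    linarith [norm_oneSubChar_le_two ξ y, norm_nonneg ξ]
  · rw [min_eq_right h]
    calc ‖oneSubChar ξ y‖ ≤ ‖⟪ξ, y⟫‖ := by
          rw [oneSubChar, norm_sub_rev]
          exact Real.norm_exp_I_mul_ofReal_sub_one_le
      _ ≤ ‖ξ‖ * ‖y‖ := norm_inner_le_norm ξ y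
      _ ≤ (2 + ‖ξ‖) * ‖y‖ := by gcongr; linarith

theorem re_oneSubChar_nonneg (ξ y : E) : 0 ≤ (oneSubChar ξ y).re := by
  have := Complex.re_le_norm (Complex.exp (Complex.I * (⟪ξ, y⟫ : ℂ)))
  rw [Complex.norm_exp_I_mul_ofReal] at this
  simpa [oneSubChar] using this

theorem oneSubChar_comm (x y : E) : oneSubChar x y = oneSubChar y x := by
  simp [oneSubChar, real_inner_comm]

theorem oneSubChar_mul (η ξ y : E) : oneSubChar η y * oneSubChar ξ y =
    oneSubChar η y + oneSubChar ξ y - oneSubChar (η + ξ) y := by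
  simp only [oneSubChar, inner_add_left, Complex.ofReal_add, mul_add, Complex.exp_add]
  ring

variable [MeasurableSpace E]

/-- The characteristic exponent of the driftless pure-jump process with Lévy measure `ν`. -/
noncomputable def levySymbol (ν : Measure E) (ξ : E) : ℂ := ∫ y, oneSubChar ξ y ∂ν

variable {ν : Measure E}

theorem levySymbol_smul (c : ℝ≥0∞) (σ : Measure E) (ξ : E) :
    levySymbol (c • σ) ξ = c.toReal • levySymbol σ ξ := integral_smul_measure _ _

theorem levySymbol_withDensity {w : E → ℝ} (hw : Measurable w) (hw0 : ∀ y, 0 ≤ w y) (ξ : E) :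
    levySymbol (ν.withDensity fun y => ENNReal.ofReal (w y)) ξ = ∫ y, w y • oneSubChar ξ y ∂ν := by
  rw [levySymbol, integral_withDensity_eq_integral_toReal_smul hw.ennreal_ofReal
    (ae_of_all _ fun _ => ENNReal.ofReal_lt_top)]
  simp only [ENNReal.toReal_ofReal (hw0 _)]

theorem norm_levySymbol_le (hν : Integrable (fun y : E => min 1 ‖y‖) ν) (ξ : E) :
    ‖levySymbol ν ξ‖ ≤ (2 + ‖ξ‖) * ∫ y, min 1 ‖y‖ ∂ν := by
  rw [← integral_const_mul]
  exact norm_integral_le_of_norm_le (hν.const_mul _) (ae_of_all _ fun y => norm_oneSubChar_le ξ y)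

variable [BorelSpace E]

theorem aestronglyMeasurable_oneSubChar (ξ : E) (ν : Measure E) :
    AEStronglyMeasurable (oneSubChar ξ) ν :=
  (continuous_oneSubChar.comp (Continuous.prodMk_right ξ)).aestronglyMeasurable

theorem integrable_oneSubChar (hν : Integrable (fun y : E => min 1 ‖y‖) ν) (ξ : E) :
    Integrable (oneSubChar ξ) ν :=
  (hν.const_mul (2 + ‖ξ‖)).mono' (aestronglyMeasurable_oneSubChar ξ ν)
    (ae_of_all _ fun y => norm_oneSubChar_le ξ y)

theorem re_levySymbol_nonneg (hν : Integrable (fun y : E => min 1 ‖y‖) ν) (ξ : E) :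
    0 ≤ (levySymbol ν ξ).re := by
  have h : (levySymbol ν ξ).re = ∫ y, (oneSubChar ξ y).re ∂ν :=
    (integral_re (integrable_oneSubChar hν ξ)).symm
  rw [h]
  exact integral_nonneg fun y => re_oneSubChar_nonneg ξ y

theorem continuous_levySymbol (hν : Integrable (fun y : E => min 1 ‖y‖) ν) :
    Continuous (levySymbol ν) := by
  refine continuous_iff_continuousAt.2 fun ξ₀ => ?_
  refine continuousAt_of_dominated (bound := fun y => (2 + (‖ξ₀‖ + 1)) * min 1 ‖y‖)
    (Eventually.of_forall fun ξ => aestronglyMeasurable_oneSubChar ξ ν) ?_ (hν.const_mul _)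
    (ae_of_all _ fun y => (continuous_oneSubChar.comp (Continuous.prodMk_left y)).continuousAt)
  have : ∀ᶠ ξ : E in 𝓝 ξ₀, ‖ξ‖ < ‖ξ₀‖ + 1 :=
    continuous_norm.continuousAt.eventually_lt continuousAt_const (by simp)
  filter_upwards [this] with ξ hξ
  refine ae_of_all _ fun y => (norm_oneSubChar_le ξ y).trans ?_
  gcongr

theorem charFun_eq_one_sub_levySymbol (μ : Measure E) [IsProbabilityMeasure μ] (ξ : E) :
    charFun μ ξ = 1 - levySymbol μ ξ := by
  have h : Integrable (fun y => Complex.exp (Complex.I * (⟪ξ, y⟫ : ℂ))) μ :=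
    (integrable_const (1 : ℝ)).mono' (by fun_prop)
      (ae_of_all _ fun y => (Complex.norm_exp_I_mul_ofReal _).le)
  rw [levySymbol]
  simp only [oneSubChar]
  rw [integral_sub (integrable_const _) h, charFun_apply]
  simp [real_inner_comm, mul_comm]

end LevySymbol

section LevyContinuity

variable {E : Type*} [NormedAddCommGroup E] [MeasurableSpace E]

/-- The measure `σ` with its missing mass put at the origin. -/
noncomputable def fillAtZero (σ : Measure E) : Measure E := σ + (1 - σ Set.univ) • Measure.dirac 0

theorem isProbabilityMeasure_fillAtZero {σ : Measure E} (hσ : σ Set.univ ≤ 1) :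
    IsProbabilityMeasure (fillAtZero σ) :=
  ⟨by simp [fillAtZero, add_tsub_cancel_of_le hσ]⟩

theorem lintegral_fillAtZero (σ : Measure E) {f : E → ℝ≥0∞} (hf : Measurable f) (hf0 : f 0 = 0) :
    ∫⁻ x, f x ∂(fillAtZero σ) = ∫⁻ x, f x ∂σ := by
  simp [fillAtZero, lintegral_add_measure, lintegral_smul_measure, lintegral_dirac' _ hf, hf0]

variable [BorelSpace E]

theorem integral_fillAtZero {F : Type*} [NormedAddCommGroup F] [NormedSpace ℝ F]
    [CompleteSpace F] {σ : Measure E} {f : E → F}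
    (hf : Integrable f σ) (hf0 : f 0 = 0) : ∫ x, f x ∂(fillAtZero σ) = ∫ x, f x ∂σ := by
  have h0 : Integrable f (Measure.dirac 0) := integrable_dirac (by simp [hf0])
  rw [fillAtZero, integral_add_measure hf (h0.smul_measure (by finiteness)),
    integral_smul_measure, integral_dirac, hf0, smul_zero, add_zero]

variable [InnerProductSpace ℝ E]

theorem charFun_fillAtZero {σ : Measure E} (hσ : σ Set.univ ≤ 1) (ξ : E) :
    charFun (fillAtZero σ) ξ = 1 - levySymbol σ ξ := by
  have := isProbabilityMeasure_fillAtZero hσ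
  have : IsFiniteMeasure σ := ⟨hσ.trans_lt ENNReal.one_lt_top⟩
  rw [charFun_eq_one_sub_levySymbol, levySymbol, levySymbol,
    integral_fillAtZero _ (oneSubChar_zero_right ξ)]
  exact (integrable_const (2 : ℝ)).mono' (aestronglyMeasurable_oneSubChar ξ σ)
    (ae_of_all _ fun y => norm_oneSubChar_le_two ξ y)

variable [FiniteDimensional ℝ E]

theorem tendsto_integral_of_tendsto_levySymbol_of_le_one {σ : ℕ → Measure E} {σ' : Measure E}
    (hσ : ∀ n, σ n Set.univ ≤ 1) (hσ' : σ' Set.univ ≤ 1)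
    (h : ∀ ξ, Tendsto (fun n => levySymbol (σ n) ξ) atTop (𝓝 (levySymbol σ' ξ)))
    (f : BoundedContinuousFunction E ℝ) (hf0 : f 0 = 0) :
    Tendsto (fun n => ∫ x, f x ∂(σ n)) atTop (𝓝 (∫ x, f x ∂σ')) := by
  have hfin : ∀ n, IsFiniteMeasure (σ n) := fun n => ⟨(hσ n).trans_lt ENNReal.one_lt_top⟩
  have hfin' : IsFiniteMeasure σ' := ⟨hσ'.trans_lt ENNReal.one_lt_top⟩
  let P : ℕ → ProbabilityMeasure E := fun n =>
    ⟨fillAtZero (σ n), isProbabilityMeasure_fillAtZero (hσ n)⟩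
  let P' : ProbabilityMeasure E := ⟨fillAtZero σ', isProbabilityMeasure_fillAtZero hσ'⟩
  have hP : Tendsto P atTop (𝓝 P') := by
    refine ProbabilityMeasure.tendsto_of_tendsto_charFun fun ξ => ?_
    simp only [P, P', ProbabilityMeasure.coe_mk, charFun_fillAtZero (hσ _), charFun_fillAtZero hσ']
    exact (h ξ).const_sub 1
  have := ProbabilityMeasure.tendsto_iff_forall_integral_tendsto.1 hP f
  simpa only [P, P', ProbabilityMeasure.coe_mk, integral_fillAtZero (f.integrable _) hf0] using this

/-- A form of Lévy's continuity theorem for finite measures, with the mass at the origin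
disregarded. -/
theorem tendsto_integral_of_tendsto_levySymbol {σ : ℕ → Measure E} {σ' : Measure E} {M : ℝ≥0∞}
    (hM : M ≠ ∞) (hσ : ∀ n, σ n Set.univ ≤ M) (hσ' : σ' Set.univ ≤ M)
    (h : ∀ ξ, Tendsto (fun n => levySymbol (σ n) ξ) atTop (𝓝 (levySymbol σ' ξ)))
    (f : BoundedContinuousFunction E ℝ) (hf0 : f 0 = 0) :
    Tendsto (fun n => ∫ x, f x ∂(σ n)) atTop (𝓝 (∫ x, f x ∂σ')) := by
  have hle : ∀ a ≤ M, (M + 1)⁻¹ * a ≤ 1 := fun a ha => by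
    rw [mul_comm, ← div_eq_mul_inv]
    exact ENNReal.div_le_of_le_mul (by simpa using ha.trans le_self_add)
  have hc : (M + 1)⁻¹.toReal ≠ 0 :=
    (ENNReal.toReal_pos (ENNReal.inv_ne_zero.2 (by finiteness)) (by simp)).ne'
  have key := tendsto_integral_of_tendsto_levySymbol_of_le_one
    (σ := fun n => (M + 1)⁻¹ • σ n) (σ' := (M + 1)⁻¹ • σ')
    (fun n => by simpa using hle _ (hσ n)) (by simpa using hle _ hσ')
    (fun ξ => by simpa only [levySymbol_smul] using (h ξ).const_smul _) f hf0
  simp only [integral_smul_measure] at key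
  simpa only [inv_smul_smul₀ hc] using key.const_smul ((M + 1)⁻¹.toReal)⁻¹

end LevyContinuity

section ConvolutionPower

variable {E : Type*} [NormedAddCommGroup E] [InnerProductSpace ℝ E] [MeasurableSpace E]

/-- The `n`-fold convolution power of a measure. -/
noncomputable def convPow (ρ : Measure E) : ℕ → Measure E
  | 0 => Measure.dirac 0
  | n + 1 => convPow ρ n ∗ ρ

variable [BorelSpace E] [FiniteDimensional ℝ E]

instance isProbabilityMeasure_convPow (ρ : Measure E) [IsProbabilityMeasure ρ] (n : ℕ) :
    IsProbabilityMeasure (convPow ρ n) := by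
  induction n with
  | zero => exact Measure.dirac.isProbabilityMeasure
  | succ n ih => exact Measure.probabilitymeasure_of_probabilitymeasures_conv _ _

theorem charFun_convPow (ρ : Measure E) [IsProbabilityMeasure ρ] (n : ℕ) (ξ : E) :
    charFun (convPow ρ n) ξ = charFun ρ ξ ^ n := by
  induction n with
  | zero => simp [convPow]
  | succ n ih => rw [convPow, charFun_conv, ih, pow_succ]

theorem lintegral_convPow_le (ρ : Measure E) [IsProbabilityMeasure ρ] {φ : E → ℝ≥0∞}
    (hφ : Measurable φ) (hφ0 : φ 0 = 0) (hadd : ∀ x y, φ (x + y) ≤ φ x + φ y) (n : ℕ) :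
    ∫⁻ x, φ x ∂(convPow ρ n) ≤ n * ∫⁻ x, φ x ∂ρ := by
  induction n with
  | zero => simp [convPow, lintegral_dirac' _ hφ, hφ0]
  | succ n ih =>
    calc ∫⁻ x, φ x ∂(convPow ρ (n + 1)) = ∫⁻ x, ∫⁻ y, φ (x + y) ∂ρ ∂(convPow ρ n) :=
          Measure.lintegral_conv hφ
      _ ≤ ∫⁻ x, ∫⁻ y, (φ x + φ y) ∂ρ ∂(convPow ρ n) := by gcongr; exact hadd _ _
      _ = ∫⁻ x, φ x ∂(convPow ρ n) + ∫⁻ y, φ y ∂ρ := by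
          simp [lintegral_add_right _ hφ, lintegral_add_left hφ]
      _ ≤ (n + 1 : ℕ) * ∫⁻ x, φ x ∂ρ := by
          rw [Nat.cast_succ, add_mul, one_mul]; gcongr

end ConvolutionPower

section TimeScaling

variable {E : Type*} [NormedAddCommGroup E] [InnerProductSpace ℝ E] [MeasurableSpace E]
  [BorelSpace E] {ν : Measure E}

theorem tendsto_truncated_levySymbol (hν : Integrable (fun y : E => min 1 ‖y‖) ν) {a : ℝ}
    (ha : 0 < a) (ξ : E) :
    Tendsto (fun n : ℕ => ∫ y, min 1 (a * n * min 1 ‖y‖) • oneSubChar ξ y ∂ν) atTop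
      (𝓝 (levySymbol ν ξ)) := by
  refine tendsto_integral_of_dominated_convergence (fun y => (2 + ‖ξ‖) * min 1 ‖y‖)
    (fun n => (by fun_prop : Measurable fun y : E =>
      min 1 (a * n * min 1 ‖y‖)).aestronglyMeasurable.smul (aestronglyMeasurable_oneSubChar ξ ν))
    (hν.const_mul _) (fun n => ae_of_all _ fun y => ?_) (ae_of_all _ fun y => ?_)
  · rw [norm_smul, Real.norm_of_nonneg (by positivity)]
    exact (mul_le_of_le_one_left (norm_nonneg _) (min_le_left _ _)).trans (norm_oneSubChar_le ξ y)
  · rcases eq_or_ne y 0 with rfl | hy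
    · simp [oneSubChar_zero_right]
    · have hk : 0 < min 1 ‖y‖ := lt_min one_pos (norm_pos_iff.2 hy)
      have h1 : Tendsto (fun n : ℕ => a * n * min 1 ‖y‖) atTop atTop :=
        (tendsto_natCast_atTop_atTop.const_mul_atTop ha).atTop_mul_const hk
      refine tendsto_const_nhds.congr' ?_
      filter_upwards [h1.eventually_ge_atTop 1] with n hn
      rw [min_eq_left hn, one_smul]

variable [FiniteDimensional ℝ E]

/-- A subadditive function vanishing at the origin has expectation at most `t ∫ φ dν` under the law
at time `t` of the driftless pure-jump process with Lévy measure `ν`. -/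
theorem lintegral_le_of_charFun_eq (hν : Integrable (fun y : E => min 1 ‖y‖) ν) {t : ℝ}
    (ht : 0 ≤ t) (P : Measure E) [IsProbabilityMeasure P]
    (hP : ∀ ξ, charFun P ξ = Complex.exp (-(t : ℂ) * levySymbol ν ξ))
    (φ : BoundedContinuousFunction E ℝ) (hφ : ∀ x, 0 ≤ φ x) (hφ0 : φ 0 = 0)
    (hadd : ∀ x y, φ (x + y) ≤ φ x + φ y) :
    ∫⁻ x, ENNReal.ofReal (φ x) ∂P ≤ ENNReal.ofReal t * ∫⁻ x, ENNReal.ofReal (φ x) ∂ν := by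
  set c : ℝ := ∫ y, min 1 ‖y‖ ∂ν with hc
  have hc0 : 0 ≤ c := integral_nonneg fun y => by positivity
  set a : ℝ := (t * c + 1)⁻¹ with ha
  have ha0 : 0 < a := by positivity
  have hφm : Measurable fun x => ENNReal.ofReal (φ x) := φ.continuous.measurable.ennreal_ofReal
  have hφ0' : ENNReal.ofReal (φ 0) = 0 := by rw [hφ0, ENNReal.ofReal_zero]
  have hwm : ∀ n : ℕ, Measurable fun y : E => min 1 (a * n * min 1 ‖y‖) := fun n => by fun_prop
  have hw0 : ∀ (n : ℕ) (y : E), 0 ≤ min 1 (a * n * min 1 ‖y‖) := fun n y => by positivity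
  let σ : ℕ → Measure E := fun n => ENNReal.ofReal (t / n) •
    ν.withDensity fun y => ENNReal.ofReal (min 1 (a * n * min 1 ‖y‖))
  have hσ : ∀ n, σ n Set.univ ≤ 1 := fun n => by
    calc σ n Set.univ
        = ENNReal.ofReal (t / n) * ∫⁻ y, ENNReal.ofReal (min 1 (a * n * min 1 ‖y‖)) ∂ν := by
          simp [σ]
      _ ≤ ENNReal.ofReal (t / n) * ∫⁻ y, ENNReal.ofReal (a * n * min 1 ‖y‖) ∂ν := by
          gcongr; exact min_le_right _ _
      _ = ENNReal.ofReal (t / n * (a * n * c)) := by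
          rw [← ofReal_integral_eq_lintegral_ofReal (hν.const_mul _)
            (ae_of_all _ fun y => by positivity), integral_const_mul,
            ← ENNReal.ofReal_mul (by positivity)]
      _ ≤ 1 := by
          rw [ENNReal.ofReal_le_one]
          rcases eq_or_ne (n : ℝ) 0 with hn | hn
          · simp [hn]
          · rw [show t / n * (a * n * c) = (t * c) / (t * c + 1) by
                rw [ha]; field_simp]
            exact div_le_one_of_le₀ (by linarith) (by positivity)
  let ρ : ℕ → Measure E := fun n => fillAtZero (σ n)
  have hρ : ∀ n, IsProbabilityMeasure (ρ n) := fun n => isProbabilityMeasure_fillAtZero (hσ n)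
  have hlim : ∀ ξ, Tendsto (fun n => charFun (convPow (ρ n) n) ξ) atTop (𝓝 (charFun P ξ)) := by
    intro ξ
    simp only [charFun_convPow, hP, ρ, charFun_fillAtZero (hσ _), sub_eq_add_neg]
    refine Complex.tendsto_one_add_pow_exp_of_tendsto ?_
    refine ((tendsto_truncated_levySymbol hν ha0 ξ).const_mul (-(t : ℂ))).congr' ?_
    filter_upwards [eventually_ne_atTop 0] with n hn
    rw [levySymbol_smul, levySymbol_withDensity (hwm n) (hw0 n),
      ENNReal.toReal_ofReal (by positivity), Complex.real_smul]
    push_cast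
    have : (n : ℂ) ≠ 0 := by exact_mod_cast hn
    field_simp
  let Q : ℕ → ProbabilityMeasure E := fun n => ⟨convPow (ρ n) n, inferInstance⟩
  let P' : ProbabilityMeasure E := ⟨P, inferInstance⟩
  have hweak : Tendsto Q atTop (𝓝 P') := ProbabilityMeasure.tendsto_of_tendsto_charFun hlim
  have hconv : Tendsto (fun n => ∫⁻ x, ENNReal.ofReal (φ x) ∂(convPow (ρ n) n)) atTop
      (𝓝 (∫⁻ x, ENNReal.ofReal (φ x) ∂P)) := by
    have h := (ENNReal.continuous_ofReal.tendsto _).comp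
      (ProbabilityMeasure.tendsto_iff_forall_integral_tendsto.1 hweak φ)
    simpa only [Function.comp_def, Q, P', ProbabilityMeasure.coe_mk,
      ofReal_integral_eq_lintegral_ofReal (φ.integrable _) (ae_of_all _ hφ)] using h
  refine le_of_tendsto' hconv fun n => ?_
  calc ∫⁻ x, ENNReal.ofReal (φ x) ∂(convPow (ρ n) n) ≤ n * ∫⁻ x, ENNReal.ofReal (φ x) ∂(ρ n) :=
        lintegral_convPow_le _ hφm hφ0' (fun x y =>
          (ENNReal.ofReal_le_ofReal (hadd x y)).trans ENNReal.ofReal_add_le) n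
    _ = n * ∫⁻ x, ENNReal.ofReal (φ x) ∂(σ n) := by rw [lintegral_fillAtZero _ hφm hφ0']
    _ = n * (ENNReal.ofReal (t / n) *
          ∫⁻ x, ENNReal.ofReal (min 1 (a * n * min 1 ‖x‖)) * ENNReal.ofReal (φ x) ∂ν) := by
        rw [lintegral_smul_measure, lintegral_withDensity_eq_lintegral_mul _
          (hwm n).ennreal_ofReal hφm]
        rfl
    _ ≤ n * (ENNReal.ofReal (t / n) * ∫⁻ x, ENNReal.ofReal (φ x) ∂ν) := by
        gcongr with x
        exact mul_le_of_le_one_left' (ENNReal.ofReal_le_one.2 (min_le_left _ _))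
    _ ≤ ENNReal.ofReal t * ∫⁻ x, ENNReal.ofReal (φ x) ∂ν := by
        rw [← mul_assoc]
        gcongr
        rw [← ENNReal.ofReal_natCast, ← ENNReal.ofReal_mul (by positivity)]
        refine ENNReal.ofReal_le_ofReal ?_
        rcases eq_or_ne (n : ℝ) 0 with hn | hn
        · simpa [hn] using ht
        · exact (mul_div_cancel₀ t hn).le

theorem lintegral_min_const_mul_norm_rpow_le (hν : Integrable (fun y : E => min 1 ‖y‖) ν) {t : ℝ}
    (ht : 0 ≤ t) (P : Measure E) [IsProbabilityMeasure P]
    (hP : ∀ ξ, charFun P ξ = Complex.exp (-(t : ℂ) * levySymbol ν ξ))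
    {B κ β : ℝ} (hB : 0 ≤ B) (hκ : 0 ≤ κ) (hβ0 : 0 < β) (hβ1 : β ≤ 1) :
    ∫⁻ x, ENNReal.ofReal (min B (κ * ‖x‖ ^ β)) ∂P ≤
      ENNReal.ofReal t * ∫⁻ x, ENNReal.ofReal (min B (κ * ‖x‖ ^ β)) ∂ν := by
  have hcont : Continuous fun x : E => min B (κ * ‖x‖ ^ β) :=
    continuous_const.min (continuous_const.mul (continuous_norm.rpow_const fun _ => Or.inr hβ0.le))
  have hnonneg : ∀ x : E, 0 ≤ min B (κ * ‖x‖ ^ β) := fun x => by positivity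
  refine lintegral_le_of_charFun_eq hν ht P hP
    (BoundedContinuousFunction.ofNormedAddCommGroup _ hcont B fun x => ?_) hnonneg ?_
    fun x y => ?_
  · rw [Real.norm_of_nonneg (hnonneg x)]
    exact min_le_left _ _
  · simp [Real.zero_rpow hβ0.ne', hB]
  · simp only [BoundedContinuousFunction.coe_ofNormedAddCommGroup]
    have h : κ * ‖x + y‖ ^ β ≤ κ * ‖x‖ ^ β + κ * ‖y‖ ^ β := by
      rw [← mul_add]
      gcongr
      exact (Real.rpow_le_rpow (norm_nonneg _) (norm_add_le x y) hβ0.le).trans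
        (Real.rpow_add_le_add_rpow (norm_nonneg x) (norm_nonneg y) hβ0.le hβ1)
    have hx : 0 ≤ κ * ‖x‖ ^ β := by positivity
    have hy : 0 ≤ κ * ‖y‖ ^ β := by positivity
    rcases le_total B (κ * ‖x‖ ^ β) with h1 | h1 <;>
      rcases le_total B (κ * ‖y‖ ^ β) with h2 | h2 <;>
      simp only [min_eq_left, min_eq_right, h1, h2, min_le_iff] <;> grind

end TimeScaling

section GaussianWeight

open ProbabilityTheory

variable {E : Type*} [NormedAddCommGroup E]

/-- A bounded weight comparable with `min 1 ‖x‖²`, whose multiplication operator acts on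
characteristic functions as an average over Gaussian translations. -/
noncomputable def gaussianWeight (x : E) : ℝ := 1 - Real.exp (-‖x‖ ^ 2 / 2)

theorem gaussianWeight_nonneg (x : E) : 0 ≤ gaussianWeight x := by
  rw [gaussianWeight, sub_nonneg, Real.exp_le_one_iff]
  linarith [sq_nonneg ‖x‖]

theorem gaussianWeight_le (x : E) : gaussianWeight x ≤ min 1 ‖x‖ := by
  have h0 := norm_nonneg x
  have h1 := Real.add_one_le_exp (-‖x‖ ^ 2 / 2)
  have h2 := Real.exp_pos (-‖x‖ ^ 2 / 2)
  rw [gaussianWeight]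
  refine le_min (by linarith) ?_
  rcases le_total 1 ‖x‖ with h | h <;> nlinarith

theorem continuous_gaussianWeight : Continuous (gaussianWeight : E → ℝ) := by
  unfold gaussianWeight; fun_prop

variable [InnerProductSpace ℝ E] [FiniteDimensional ℝ E] [MeasurableSpace E] [BorelSpace E]

theorem levySymbol_stdGaussian (x : E) :
    levySymbol (stdGaussian E) x = (gaussianWeight x : ℂ) := by
  have h := charFun_eq_one_sub_levySymbol (stdGaussian E) x
  rw [charFun_stdGaussian] at h
  rw [gaussianWeight]
  push_cast
  linear_combination h

theorem levySymbol_withDensity_gaussianWeight {m : Measure E} [SFinite m]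
    (hm : Integrable (fun y : E => min 1 ‖y‖) m) (η : E) :
    levySymbol (m.withDensity fun y => ENNReal.ofReal (gaussianWeight y)) η =
      ∫ ξ, (levySymbol m η + levySymbol m ξ - levySymbol m (η + ξ)) ∂(stdGaussian E) := by
  have hint : Integrable (fun z : E × E => oneSubChar η z.1 * oneSubChar z.2 z.1)
      (m.prod (stdGaussian E)) := by
    have hnorm : Integrable (fun ξ : E => 2 * (2 + ‖ξ‖)) (stdGaussian E) :=
      ((integrable_const 2).add IsGaussian.integrable_id.norm).const_mul 2
    refine (hm.mul_prod hnorm).mono' (Continuous.aestronglyMeasurable ?_)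
      (ae_of_all _ fun z => ?_)
    · exact (continuous_oneSubChar.comp (continuous_const.prodMk continuous_fst)).mul
        (continuous_oneSubChar.comp (continuous_snd.prodMk continuous_fst))
    · rw [norm_mul]
      calc ‖oneSubChar η z.1‖ * ‖oneSubChar z.2 z.1‖
          ≤ 2 * ((2 + ‖z.2‖) * min 1 ‖z.1‖) := by
            gcongr
            exacts [norm_oneSubChar_le_two _ _, norm_oneSubChar_le _ _]
        _ = min 1 ‖z.1‖ * (2 * (2 + ‖z.2‖)) := by ring
  rw [levySymbol_withDensity continuous_gaussianWeight.measurable gaussianWeight_nonneg]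
  calc ∫ y, gaussianWeight y • oneSubChar η y ∂m
      = ∫ y, ∫ ξ, oneSubChar η y * oneSubChar ξ y ∂(stdGaussian E) ∂m := by
        congr with y
        rw [integral_const_mul, Complex.real_smul, ← levySymbol_stdGaussian, mul_comm, levySymbol]
        simp only [oneSubChar_comm y]
    _ = ∫ ξ, ∫ y, oneSubChar η y * oneSubChar ξ y ∂m ∂(stdGaussian E) :=
        integral_integral_swap hint
    _ = _ := by
        congr with ξ
        simp only [oneSubChar_mul, levySymbol]
        have h1 := integrable_oneSubChar hm η
        have h2 := integrable_oneSubChar hm ξ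
        exact (integral_sub (h1.add h2) (integrable_oneSubChar hm _)).trans
          (congrArg (· - _) (integral_add h1 h2))

end GaussianWeight

section SmallTime

open ProbabilityTheory

variable {E : Type*} [NormedAddCommGroup E] [InnerProductSpace ℝ E] [FiniteDimensional ℝ E]
  [MeasurableSpace E] [BorelSpace E] {ν : Measure E}

theorem tendsto_inv_smul_levySymbol_withDensity (hν0 : ν {0} = 0)
    (hν : Integrable (fun y : E => min 1 ‖y‖) ν) {p : ℕ → Measure E}
    [∀ n, IsProbabilityMeasure (p n)] {t : ℕ → ℝ} (ht : ∀ n, 0 < t n)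
    (ht0 : Tendsto t atTop (𝓝 0))
    (hp : ∀ n ξ, charFun (p n) ξ = Complex.exp (-(t n : ℂ) * levySymbol ν ξ)) (η : E) :
    Tendsto (fun n => (t n)⁻¹ •
        levySymbol ((p n).withDensity fun y => ENNReal.ofReal (gaussianWeight y)) η) atTop
      (𝓝 (levySymbol (ν.withDensity fun y => ENNReal.ofReal (gaussianWeight y)) η)) := by
  have := sigmaFinite_of_integrable_min_norm hν0 hν
  have hpint : ∀ n, Integrable (fun y : E => min 1 ‖y‖) (p n) := fun n =>
    (integrable_const (1 : ℝ)).mono' (by fun_prop) (ae_of_all _ fun y => by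
      rw [Real.norm_of_nonneg (by positivity)]; exact min_le_left _ _)
  have hsymb : ∀ n ξ, levySymbol (p n) ξ = 1 - Complex.exp (-(t n : ℂ) * levySymbol ν ξ) :=
    fun n ξ => by rw [← hp, charFun_eq_one_sub_levySymbol, sub_sub_cancel]
  set c := ∫ y, min 1 ‖y‖ ∂ν with hc
  have hbound : ∀ n ξ, ‖(t n)⁻¹ • levySymbol (p n) ξ‖ ≤ (2 + ‖ξ‖) * c := fun n ξ => by
    refine le_trans ?_ (norm_levySymbol_le hν ξ)
    have hz : 0 ≤ ((t n : ℂ) * levySymbol ν ξ).re := by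
      rw [Complex.re_ofReal_mul]
      exact mul_nonneg (ht n).le (re_levySymbol_nonneg hν ξ)
    have h := norm_one_sub_exp_neg_le hz
    rw [norm_mul, Complex.norm_of_nonneg (ht n).le, ← neg_mul, ← hsymb] at h
    rw [norm_smul, norm_inv, Real.norm_of_nonneg (ht n).le]
    exact inv_mul_le_of_le_mul₀ (ht n).le (norm_nonneg _) h
  have hlim : ∀ ξ, Tendsto (fun n => (t n)⁻¹ • levySymbol (p n) ξ) atTop (𝓝 (levySymbol ν ξ)) :=
    fun ξ => by simpa only [hsymb] using tendsto_inv_mul_one_sub_exp (levySymbol ν ξ) ht ht0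
  simp only [levySymbol_withDensity_gaussianWeight hν,
    levySymbol_withDensity_gaussianWeight (hpint _), ← integral_smul, smul_sub, smul_add]
  have hint : Integrable (fun ξ : E => (2 + ‖η‖) * c + (2 + ‖ξ‖) * c + (2 + (‖η‖ + ‖ξ‖)) * c)
      (stdGaussian E) := by
    have h : Integrable (fun ξ : E => ‖ξ‖) (stdGaussian E) := IsGaussian.integrable_id.norm
    fun_prop
  refine tendsto_integral_of_dominated_convergence _ (fun n => ?_) hint
    (fun n => ae_of_all _ fun ξ => ?_)
    (ae_of_all _ fun ξ => ((hlim η).add (hlim ξ)).sub (hlim (η + ξ)))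
  · have h := continuous_levySymbol (hpint n)
    exact Continuous.aestronglyMeasurable (by fun_prop)
  · have hc0 : 0 ≤ c := integral_nonneg fun y => by positivity
    refine (norm_sub_le _ _).trans (add_le_add ((norm_add_le _ _).trans
      (add_le_add (hbound n η) (hbound n ξ))) ((hbound n _).trans ?_))
    gcongr
    exact norm_add_le η ξ

theorem tendsto_inv_mul_integral_gaussianWeight (hν0 : ν {0} = 0)
    (hν : Integrable (fun y : E => min 1 ‖y‖) ν) {p : ℕ → Measure E}
    [∀ n, IsProbabilityMeasure (p n)] {t : ℕ → ℝ} (ht : ∀ n, 0 < t n)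
    (ht0 : Tendsto t atTop (𝓝 0))
    (hp : ∀ n ξ, charFun (p n) ξ = Complex.exp (-(t n : ℂ) * levySymbol ν ξ))
    (F : BoundedContinuousFunction E ℝ) (hF0 : F 0 = 0) :
    Tendsto (fun n => (t n)⁻¹ * ∫ x, gaussianWeight x * F x ∂(p n)) atTop
      (𝓝 (∫ x, gaussianWeight x * F x ∂ν)) := by
  have hwd : ∀ m : Measure E, ∫ x, F x ∂(m.withDensity fun y => ENNReal.ofReal (gaussianWeight y))
      = ∫ x, gaussianWeight x * F x ∂m := fun m => by
    rw [integral_withDensity_eq_integral_toReal_smul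
      continuous_gaussianWeight.measurable.ennreal_ofReal
      (ae_of_all _ fun _ => ENNReal.ofReal_lt_top)]
    simp only [ENNReal.toReal_ofReal (gaussianWeight_nonneg _), smul_eq_mul]
  have hM : ∫⁻ x, ENNReal.ofReal (min 1 ‖x‖) ∂ν ≠ ∞ := by
    rw [← ofReal_integral_eq_lintegral_ofReal hν (ae_of_all _ fun y => by positivity)]
    finiteness
  have hmass : ∀ m : Measure E,
      (m.withDensity fun y => ENNReal.ofReal (gaussianWeight y)) Set.univ ≤
        ∫⁻ x, ENNReal.ofReal (min 1 ‖x‖) ∂m := fun m => by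
    rw [withDensity_apply _ MeasurableSet.univ, Measure.restrict_univ]
    gcongr
    exact gaussianWeight_le _
  have key := tendsto_integral_of_tendsto_levySymbol
    (σ := fun n => ENNReal.ofReal (t n)⁻¹ •
      (p n).withDensity fun y => ENNReal.ofReal (gaussianWeight y)) hM (fun n => ?_) (hmass ν)
    (fun η => ?_) F hF0
  · simpa only [integral_smul_measure, hwd, ENNReal.toReal_ofReal (inv_nonneg.2 (ht _).le),
      smul_eq_mul] using key
  · have h := lintegral_min_const_mul_norm_rpow_le hν (ht n).le (p n) (hp n) (B := 1)
      (κ := 1) (β := 1) zero_le_one zero_le_one one_pos le_rfl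
    simp only [Real.rpow_one, one_mul] at h
    rw [Measure.smul_apply, smul_eq_mul]
    grw [hmass, h]
    rw [← mul_assoc, ← ENNReal.ofReal_mul (inv_nonneg.2 (ht n).le), inv_mul_cancel₀ (ht n).ne',
      ENNReal.ofReal_one, one_mul]
  · simpa only [levySymbol_smul, ENNReal.toReal_ofReal (inv_nonneg.2 (ht _).le)] using
      tendsto_inv_smul_levySymbol_withDensity hν0 hν ht ht0 hp η

variable {p : ℝ → Measure E}

/-- Away from the origin, `t⁻¹ p_t` converges to the Lévy measure as `t → 0+`. -/
theorem tendsto_inv_mul_integral_of_vanish (hν0 : ν {0} = 0)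
    (hν : Integrable (fun y : E => min 1 ‖y‖) ν)
    (hprob : ∀ t, 0 ≤ t → IsProbabilityMeasure (p t))
    (hp : ∀ t, 0 ≤ t → ∀ ξ, charFun (p t) ξ = Complex.exp (-(t : ℂ) * levySymbol ν ξ))
    (f : BoundedContinuousFunction E ℝ) {δ : ℝ} (hδ : 0 < δ) (hf : ∀ x, ‖x‖ ≤ δ → f x = 0) :
    Tendsto (fun t => t⁻¹ * ∫ x, f x ∂(p t)) (𝓝[>] 0) (𝓝 (∫ x, f x ∂ν)) := by
  set s : ℝ := 1 - Real.exp (-δ ^ 2 / 2) with hs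
  have hs0 : 0 < s := by
    rw [hs, sub_pos, Real.exp_lt_one_iff]
    nlinarith
  have hcont : Continuous fun x => (max s (gaussianWeight x))⁻¹ * f x :=
    ((continuous_const.max continuous_gaussianWeight).inv₀
      fun x => (hs0.trans_le (le_max_left _ _)).ne').mul f.continuous
  let F : BoundedContinuousFunction E ℝ := .ofNormedAddCommGroup _ hcont (s⁻¹ * ‖f‖) fun x => by
    rw [norm_mul, norm_inv, Real.norm_of_nonneg (hs0.le.trans (le_max_left _ _))]
    gcongr
    exacts [le_max_left _ _, f.norm_coe_le_norm x]
  have hF : ∀ x, gaussianWeight x * F x = f x := fun x => by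
    rcases le_total ‖x‖ δ with h | h
    · simp [F, hf x h]
    · have hle : s ≤ gaussianWeight x := by
        rw [hs, gaussianWeight]
        gcongr
      simp only [F, BoundedContinuousFunction.coe_ofNormedAddCommGroup, max_eq_right hle]
      rw [mul_inv_cancel_left₀ (hs0.trans_le hle).ne']
  have hF0 : F 0 = 0 := by simp [F, hf 0 (by simpa using hδ.le)]
  refine tendsto_of_seq_tendsto fun u hu => ?_
  obtain ⟨hu0, hupos⟩ := tendsto_nhdsWithin_iff.1 hu
  obtain ⟨N, hN⟩ := eventually_atTop.1 hupos
  refine (tendsto_add_atTop_iff_nat N).1 ?_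
  have hpos : ∀ n, 0 < u (n + N) := fun n => hN _ (Nat.le_add_left N n)
  have : ∀ n, IsProbabilityMeasure (p (u (n + N))) := fun n => hprob _ (hpos n).le
  simpa only [hF, Function.comp_def] using tendsto_inv_mul_integral_gaussianWeight hν0 hν hpos
    ((tendsto_add_atTop_iff_nat N).2 hu0) (fun n => hp _ (hpos n).le) F hF0

theorem tendsto_inv_mul_integral_of_small_near_zero (hν0 : ν {0} = 0)
    (hν : Integrable (fun y : E => min 1 ‖y‖) ν)
    (hprob : ∀ t, 0 ≤ t → IsProbabilityMeasure (p t))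
    (hp : ∀ t, 0 ≤ t → ∀ ξ, charFun (p t) ξ = Complex.exp (-(t : ℂ) * levySymbol ν ξ))
    (f : BoundedContinuousFunction E ℝ) (hf0 : f 0 = 0) (hf : Integrable f ν)
    (hsmall : ∀ ε > 0, ∀ᶠ δ in 𝓝[>] (0 : ℝ), ∀ t, 0 < t →
      ∫⁻ x in {x : E | ‖x‖ < δ}, ENNReal.ofReal |f x| ∂(p t) ≤ ENNReal.ofReal (t * ε)) :
    Tendsto (fun t => t⁻¹ * ∫ x, f x ∂(p t)) (𝓝[>] 0) (𝓝 (∫ x, f x ∂ν)) := by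
  let u : ℝ → E → ℝ := fun δ x => min 1 (max 0 (2 * ‖x‖ / δ - 1))
  have hu0 : ∀ δ x, 0 ≤ u δ x := fun δ x => le_min zero_le_one (le_max_left _ _)
  have hu1 : ∀ δ x, u δ x ≤ 1 := fun δ x => min_le_left _ _
  have huc : ∀ δ, Continuous (u δ) := fun δ => by fun_prop
  have hone : ∀ δ > 0, ∀ x : E, δ ≤ ‖x‖ → u δ x = 1 := fun δ hδ x hx => by
    refine min_eq_left (le_max_of_le_right ?_)
    rw [le_sub_iff_add_le, le_div_iff₀ hδ]
    linarith
  let F : ℝ → BoundedContinuousFunction E ℝ := fun δ =>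
    .ofNormedAddCommGroup (fun x => u δ x * f x) ((huc δ).mul f.continuous) ‖f‖ fun x => by
      rw [norm_mul, Real.norm_of_nonneg (hu0 δ x)]
      exact (mul_le_of_le_one_left (norm_nonneg _) (hu1 δ x)).trans (f.norm_coe_le_norm x)
  have hFlim : Tendsto (fun δ => ∫ x, F δ x ∂ν) (𝓝[>] 0) (𝓝 (∫ x, f x ∂ν)) := by
    refine tendsto_integral_filter_of_dominated_convergence (fun x => ‖f x‖)
      (Eventually.of_forall fun δ => (F δ).continuous.aestronglyMeasurable)
      (Eventually.of_forall fun δ => ae_of_all _ fun x => ?_) hf.norm (ae_of_all _ fun x => ?_)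
    · simp only [F, BoundedContinuousFunction.coe_ofNormedAddCommGroup]
      rw [norm_mul, Real.norm_of_nonneg (hu0 δ x)]
      exact mul_le_of_le_one_left (norm_nonneg _) (hu1 δ x)
    · rcases eq_or_ne x 0 with rfl | hx
      · simp [F, hf0]
      · refine tendsto_const_nhds.congr' ?_
        filter_upwards [Ioo_mem_nhdsGT (norm_pos_iff.2 hx)] with δ hδ
        simp [F, hone δ hδ.1 x hδ.2.le]
  rw [Metric.tendsto_nhds]
  intro ε hε
  obtain ⟨δ, hδ, hδν, hδp⟩ := ((eventually_mem_nhdsWithin (a := (0 : ℝ)) (s := Set.Ioi 0)).and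
    ((Metric.tendsto_nhds.1 hFlim (ε / 3) (by positivity)).and
      (hsmall (ε / 3) (by positivity)))).exists
  have hδ0 : 0 < δ := hδ
  have hvan := tendsto_inv_mul_integral_of_vanish hν0 hν hprob hp (F δ) (half_pos hδ0)
    fun x hx => by
      have : 2 * ‖x‖ / δ - 1 ≤ 0 := by
        rw [sub_nonpos, div_le_one hδ0]
        linarith
      simp [F, u, max_eq_left this]
  filter_upwards [Metric.tendsto_nhds.1 hvan (ε / 3) (by positivity), self_mem_nhdsWithin]
    with t ht ht0
  have ht0 : 0 < t := ht0
  have := hprob t ht0.le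
  have hdiff : dist (t⁻¹ * ∫ x, f x ∂(p t)) (t⁻¹ * ∫ x, F δ x ∂(p t)) ≤ ε / 3 := by
    rw [Real.dist_eq, ← mul_sub, abs_mul, abs_of_pos (inv_pos.2 ht0),
      ← integral_sub (f.integrable _) ((F δ).integrable _)]
    refine inv_mul_le_of_le_mul₀ ht0.le (by positivity) ?_
    rw [← Real.norm_eq_abs, ← toReal_enorm]
    refine ENNReal.toReal_le_of_le_ofReal (by positivity) (le_trans ?_ (hδp t ht0))
    refine (enorm_integral_le_lintegral_enorm _).trans ?_
    rw [← lintegral_indicator (measurableSet_lt measurable_norm measurable_const)]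
    refine lintegral_mono fun x => ?_
    by_cases hx : ‖x‖ < δ
    · rw [Set.indicator_of_mem (by exact hx), Real.enorm_eq_ofReal_abs]
      refine ENNReal.ofReal_le_ofReal ?_
      simp only [F, BoundedContinuousFunction.coe_ofNormedAddCommGroup]
      rw [← one_sub_mul, abs_mul, abs_of_nonneg (sub_nonneg.2 (hu1 δ x))]
      exact mul_le_of_le_one_left (abs_nonneg _) (sub_le_self _ (hu0 δ x))
    · simp [F, hone δ hδ0 x (not_lt.1 hx)]
  calc dist (t⁻¹ * ∫ x, f x ∂(p t)) (∫ x, f x ∂ν)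
      ≤ dist (t⁻¹ * ∫ x, f x ∂(p t)) (t⁻¹ * ∫ x, F δ x ∂(p t)) +
        dist (t⁻¹ * ∫ x, F δ x ∂(p t)) (∫ x, F δ x ∂ν) +
        dist (∫ x, F δ x ∂ν) (∫ x, f x ∂ν) := dist_triangle4 _ _ _ _
    _ < ε := by linarith

theorem measure_compl_zero_le_of_charFun_eq (hν : Integrable (fun y : E => min 1 ‖y‖) ν) {t : ℝ}
    (ht : 0 ≤ t) (P : Measure E) [IsProbabilityMeasure P]
    (hP : ∀ ξ, charFun P ξ = Complex.exp (-(t : ℂ) * levySymbol ν ξ)) :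
    P {0}ᶜ ≤ ENNReal.ofReal t * ν Set.univ := by
  have hlim : Tendsto (fun n : ℕ => ∫⁻ x, ENNReal.ofReal (min 1 (n * ‖x‖ ^ (1 : ℝ))) ∂P) atTop
      (𝓝 (∫⁻ x, ({0}ᶜ : Set E).indicator 1 x ∂P)) := by
    refine lintegral_tendsto_of_tendsto_of_monotone (fun n => by fun_prop)
      (ae_of_all _ fun x m n hmn => by dsimp only; gcongr) (ae_of_all _ fun x => ?_)
    rcases eq_or_ne x 0 with rfl | hx
    · simp
    · rw [Set.indicator_of_mem (by simpa using hx)]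
      have h1 : Tendsto (fun n : ℕ => (n : ℝ) * ‖x‖ ^ (1 : ℝ)) atTop atTop :=
        tendsto_natCast_atTop_atTop.atTop_mul_const (by positivity)
      refine tendsto_const_nhds.congr' ?_
      filter_upwards [h1.eventually_ge_atTop 1] with n hn
      rw [min_eq_left hn, ENNReal.ofReal_one, Pi.one_apply]
  rw [lintegral_indicator_one (measurableSet_singleton _).compl] at hlim
  refine le_of_tendsto' hlim fun n => ?_
  refine (lintegral_min_const_mul_norm_rpow_le hν ht P hP zero_le_one (Nat.cast_nonneg n)
    one_pos le_rfl).trans ?_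
  gcongr
  calc ∫⁻ x, ENNReal.ofReal (min 1 (n * ‖x‖ ^ (1 : ℝ))) ∂ν ≤ ∫⁻ _, 1 ∂ν :=
        lintegral_mono fun x => ENNReal.ofReal_le_one.2 (min_le_left _ _)
    _ = ν Set.univ := lintegral_one

end SmallTime

section NearZero

variable {E : Type*} [NormedAddCommGroup E] [MeasurableSpace E] [BorelSpace E] {ν : Measure E}

theorem measure_one_le_norm_lt_top
    (hν : ∫⁻ y, ENNReal.ofReal (min 1 (‖y‖ ^ 2)) ∂ν < ⊤) : ν {y | ‖y‖ < 1}ᶜ < ⊤ := by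
  refine lt_of_le_of_lt ?_ hν
  rw [← lintegral_indicator_one (measurableSet_lt measurable_norm measurable_const).compl]
  refine lintegral_mono fun y => Set.indicator_apply_le' (fun hy => ?_) fun _ => zero_le
  have hy : 1 ≤ ‖y‖ := by simpa using hy
  rw [min_eq_left (one_le_pow₀ hy), ENNReal.ofReal_one, Pi.one_apply]

theorem integrable_of_le_norm_rpow {β : ℝ}
    (hν : ∫⁻ y, ENNReal.ofReal (min 1 (‖y‖ ^ 2)) ∂ν < ⊤)
    (hνβ : ∫⁻ y in {y : E | ‖y‖ < 1}, ENNReal.ofReal (‖y‖ ^ β) ∂ν < ⊤)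
    {h : E → ℝ} (hm : Measurable h) {C B : ℝ} (hC : ∀ y, ‖y‖ < 1 → |h y| ≤ C * ‖y‖ ^ β)
    (hB : ∀ y, |h y| ≤ B) : Integrable h ν := by
  have hs : MeasurableSet {y : E | ‖y‖ < 1} := measurableSet_lt measurable_norm measurable_const
  refine integrableOn_univ.1 ?_
  rw [← Set.union_compl_self {y : E | ‖y‖ < 1}]
  refine IntegrableOn.union ?_ ?_
  · have hpow : IntegrableOn (fun y : E => ‖y‖ ^ β) {y | ‖y‖ < 1} ν := by
      refine ⟨(by fun_prop : Measurable fun y : E => ‖y‖ ^ β).aestronglyMeasurable, ?_⟩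
      rw [hasFiniteIntegral_iff_ofReal (ae_of_all _ fun y => by positivity)]
      exact hνβ
    exact (hpow.const_mul C).mono' hm.aestronglyMeasurable
      ((ae_restrict_iff' hs).2 (ae_of_all _ hC))
  · exact Measure.integrableOn_of_bounded (measure_one_le_norm_lt_top hν).ne
      hm.aestronglyMeasurable (ae_of_all _ hB)

theorem tendsto_lintegral_min_const_mul_norm_rpow {β : ℝ} (hβ : 0 < β) {C : ℝ} (hC : 0 < C)
    (hν : Integrable (fun y : E => min 1 (‖y‖ ^ β)) ν) :
    Tendsto (fun δ : ℝ => ∫⁻ x, ENNReal.ofReal (min (C * δ ^ β) (C * ‖x‖ ^ β)) ∂ν) (𝓝[>] 0)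
      (𝓝 0) := by
  rw [← lintegral_zero (μ := ν)]
  refine tendsto_lintegral_filter_of_dominated_convergence
    (fun x => ENNReal.ofReal (C * min 1 (‖x‖ ^ β))) (Eventually.of_forall fun δ => by fun_prop)
    ?_ ?_ (ae_of_all _ fun x => ?_)
  · filter_upwards [Ioo_mem_nhdsGT one_pos] with δ hδ
    refine ae_of_all _ fun x => ENNReal.ofReal_le_ofReal ?_
    rw [← mul_min_of_nonneg _ _ hC.le]
    gcongr
    exact Real.rpow_le_one hδ.1.le hδ.2.le hβ.le
  · exact ((hasFiniteIntegral_iff_ofReal (ae_of_all _ fun y => by positivity)).1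
      (hν.const_mul C).2).ne
  · have h : Tendsto (fun δ : ℝ => min (C * δ ^ β) (C * ‖x‖ ^ β)) (𝓝[>] 0)
        (𝓝 (min (C * 0 ^ β) (C * ‖x‖ ^ β))) :=
      (((Real.continuous_rpow_const hβ.le).tendsto 0).const_mul C).min tendsto_const_nhds
        |>.mono_left nhdsWithin_le_nhds
    have h0 : min (C * 0 ^ β) (C * ‖x‖ ^ β) = 0 := by
      rw [Real.zero_rpow hβ.ne', mul_zero, min_eq_left (by positivity)]
    rw [h0] at h
    simpa using ENNReal.tendsto_ofReal h

variable [InnerProductSpace ℝ E] [FiniteDimensional ℝ E] {p : ℝ → Measure E}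

theorem small_near_zero_of_rpow (hν : Integrable (fun y : E => min 1 ‖y‖) ν)
    (hprob : ∀ t, 0 ≤ t → IsProbabilityMeasure (p t))
    (hp : ∀ t, 0 ≤ t → ∀ ξ, charFun (p t) ξ = Complex.exp (-(t : ℂ) * levySymbol ν ξ))
    {β : ℝ} (hβ0 : 0 < β) (hβ1 : β ≤ 1) (hνβ : Integrable (fun y : E => min 1 (‖y‖ ^ β)) ν)
    {f : E → ℝ} {C : ℝ} (hC : 0 < C) (hf : ∀ x, ‖x‖ < 1 → |f x| ≤ C * ‖x‖ ^ β) {ε : ℝ}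
    (hε : 0 < ε) :
    ∀ᶠ δ in 𝓝[>] (0 : ℝ), ∀ t, 0 < t →
      ∫⁻ x in {x : E | ‖x‖ < δ}, ENNReal.ofReal |f x| ∂(p t) ≤ ENNReal.ofReal (t * ε) := by
  filter_upwards [(tendsto_lintegral_min_const_mul_norm_rpow hβ0 hC hνβ).eventually_lt_const
    (ENNReal.ofReal_pos.2 hε), Ioo_mem_nhdsGT one_pos] with δ hlt hδ t ht
  have := hprob t ht.le
  have hδ0 : 0 ≤ δ := hδ.1.le
  calc ∫⁻ x in {x : E | ‖x‖ < δ}, ENNReal.ofReal |f x| ∂(p t)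
      ≤ ∫⁻ x in {x : E | ‖x‖ < δ}, ENNReal.ofReal (min (C * δ ^ β) (C * ‖x‖ ^ β)) ∂(p t) := by
        refine setLIntegral_mono' (measurableSet_lt measurable_norm measurable_const)
          fun x hx => ENNReal.ofReal_le_ofReal ?_
        have hx : ‖x‖ < δ := hx
        have h := hf x (hx.trans hδ.2)
        refine le_min (h.trans ?_) h
        gcongr
    _ ≤ ∫⁻ x, ENNReal.ofReal (min (C * δ ^ β) (C * ‖x‖ ^ β)) ∂(p t) := setLIntegral_le_lintegral _ _
    _ ≤ ENNReal.ofReal t * ∫⁻ x, ENNReal.ofReal (min (C * δ ^ β) (C * ‖x‖ ^ β)) ∂ν :=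
        lintegral_min_const_mul_norm_rpow_le hν ht.le (p t) (hp t ht.le) (by positivity) hC.le
          hβ0 hβ1
    _ ≤ ENNReal.ofReal (t * ε) := by
        rw [ENNReal.ofReal_mul ht.le]
        gcongr

theorem small_near_zero_of_isFiniteMeasure [IsFiniteMeasure ν]
    (hν : Integrable (fun y : E => min 1 ‖y‖) ν)
    (hprob : ∀ t, 0 ≤ t → IsProbabilityMeasure (p t))
    (hp : ∀ t, 0 ≤ t → ∀ ξ, charFun (p t) ξ = Complex.exp (-(t : ℂ) * levySymbol ν ξ))
    {f : E → ℝ} (hf : Continuous f) (hf0 : f 0 = 0) {ε : ℝ} (hε : 0 < ε) :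
    ∀ᶠ δ in 𝓝[>] (0 : ℝ), ∀ t, 0 < t →
      ∫⁻ x in {x : E | ‖x‖ < δ}, ENNReal.ofReal |f x| ∂(p t) ≤ ENNReal.ofReal (t * ε) := by
  set η : ℝ := ε / (ν.real Set.univ + 1) with hη
  have hη0 : 0 < η := by positivity
  obtain ⟨δ₀, hδ₀, hball⟩ := Metric.continuousAt_iff.1 hf.continuousAt η hη0
  filter_upwards [Ioo_mem_nhdsGT hδ₀] with δ hδ t ht
  have := hprob t ht.le
  calc ∫⁻ x in {x : E | ‖x‖ < δ}, ENNReal.ofReal |f x| ∂(p t)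
      ≤ ∫⁻ x in {x : E | ‖x‖ < δ},
          ({0}ᶜ : Set E).indicator (fun _ => ENNReal.ofReal η) x ∂(p t) := by
        refine setLIntegral_mono' (measurableSet_lt measurable_norm measurable_const)
          fun x hx => ?_
        have hx : ‖x‖ < δ := hx
        rcases eq_or_ne x 0 with rfl | hx0
        · simp [hf0]
        · rw [Set.indicator_of_mem (by simpa using hx0)]
          have h : dist x 0 < δ₀ := by simpa using hx.trans hδ.2
          exact ENNReal.ofReal_le_ofReal (by simpa [hf0, Real.dist_eq] using (hball h).le)
    _ ≤ ∫⁻ x, ({0}ᶜ : Set E).indicator (fun _ => ENNReal.ofReal η) x ∂(p t) :=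
        setLIntegral_le_lintegral _ _
    _ = ENNReal.ofReal η * p t {0}ᶜ :=
        lintegral_indicator_const (measurableSet_singleton _).compl _
    _ ≤ ENNReal.ofReal η * (ENNReal.ofReal t * ν Set.univ) := by
        gcongr
        exact measure_compl_zero_le_of_charFun_eq hν ht.le (p t) (hp t ht.le)
    _ = ENNReal.ofReal (t * (η * ν.real Set.univ)) := by
        rw [← ofReal_measureReal, ← ENNReal.ofReal_mul ht.le, ← ENNReal.ofReal_mul hη0.le]
        congr 1
        ring
    _ ≤ ENNReal.ofReal (t * ε) := by
        gcongr
        rw [hη, div_mul_eq_mul_div, div_le_iff₀ (by positivity)]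
        nlinarith [measureReal_nonneg (μ := ν) (s := Set.univ)]

end NearZero

/-- Theorem 1, case 1 (0 ≤ β ≤ 1) of "Asymptotic behaviour of the heat content":
for a pure-jump Lévy process with triplet (0, γ, ν), vanishing drift γ₀ = 0
(characteristic exponent ψ(ξ) = ∫ (1 − e^{i⟨ξ,y⟩}) ν(dy)) and
∫_{‖x‖<1} ‖x‖^β ν(dx) < ∞, if the function r = g ∗ μ̌ is bounded continuous with
|r(x) − r(0)| ≤ C‖x‖^β near 0, then
t⁻¹(H_g^μ(t) − H_g^μ(0)) → ∫ (r(x) − r(0)) ν(dx) as t → 0+. -/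
theorem heat_content_finite_variation_zero_drift
    (d : ℕ) (hd : 1 ≤ d) (β : ℝ) (hβ0 : 0 ≤ β) (hβ1 : β ≤ 1)
    -- ν is a Lévy measure
    (ν : Measure (EuclideanSpace ℝ (Fin d)))
    (hν0 : ν {0} = 0)
    (hνlevy : ∫⁻ y, ENNReal.ofReal (min 1 (‖y‖ ^ 2)) ∂ν < ⊤)
    (hνβ : ∫⁻ y in {y : EuclideanSpace ℝ (Fin d) | ‖y‖ < 1},
      ENNReal.ofReal (‖y‖ ^ β) ∂ν < ⊤)
    -- the characteristic exponent of the pure-jump process with zero drift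
    (ψ : EuclideanSpace ℝ (Fin d) → ℂ)
    (hψ : ∀ ξ, ψ ξ = ∫ y, (1 - Complex.exp (Complex.I * (⟪ξ, y⟫ : ℂ))) ∂ν)
    -- (p t) are the marginal laws of the associated Lévy process
    (p : ℝ → Measure (EuclideanSpace ℝ (Fin d)))
    (hp : ∀ t, 0 ≤ t → IsProbabilityMeasure (p t))
    (hchar : ∀ t, 0 ≤ t → ∀ ξ,
      ∫ x, Complex.exp (Complex.I * (⟪ξ, x⟫ : ℂ)) ∂(p t)
        = Complex.exp (-(t : ℂ) * ψ ξ))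
    -- g bounded Borel, μ a finite Borel measure
    (g : EuclideanSpace ℝ (Fin d) → ℝ) (hgm : Measurable g)
    (Cg : ℝ) (hgbd : ∀ x, |g x| ≤ Cg)
    (μ : Measure (EuclideanSpace ℝ (Fin d))) (hμ : IsFiniteMeasure μ)
    -- r = g ∗ μ̌ is bounded and continuous
    (r : EuclideanSpace ℝ (Fin d) → ℝ)
    (hr : ∀ x, r x = ∫ y, g (x + y) ∂μ)
    (hrc : Continuous r) (Mr : ℝ) (hrbd : ∀ x, |r x| ≤ Mr)
    -- Hölder-type condition at the origin
    (C : ℝ) (hC : 0 < C)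
    (hrH : ∀ x : EuclideanSpace ℝ (Fin d), ‖x‖ < 1 → |r x - r 0| ≤ C * ‖x‖ ^ β) :
    Integrable (fun x => r x - r 0) ν ∧
      Tendsto (fun t : ℝ => t⁻¹ * ((∫ y, r y ∂(p t)) - r 0)) (𝓝[>] 0)
        (𝓝 (∫ x, (r x - r 0) ∂ν)) := by
  have hψ' : ψ = levySymbol ν := funext hψ
  have hpν : ∀ t, 0 ≤ t → ∀ ξ, charFun (p t) ξ = Complex.exp (-(t : ℂ) * levySymbol ν ξ) := by
    intro t ht ξ
    rw [← hψ', ← hchar t ht ξ, charFun_apply]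
    simp only [real_inner_comm, mul_comm]
  have hle : ∀ y : EuclideanSpace ℝ (Fin d), ‖y‖ < 1 → ‖y‖ ≤ ‖y‖ ^ β := fun y hy =>
    Real.self_le_rpow_of_le_one (norm_nonneg y) hy.le hβ1
  have hmin : Integrable (fun y => min 1 ‖y‖) ν := by
    refine integrable_of_le_norm_rpow hνlevy hνβ (by fun_prop) (C := 1) (B := 1)
      (fun y hy => ?_) fun y => ?_
    · rw [abs_of_nonneg (by positivity), one_mul]
      exact (min_le_right _ _).trans (hle y hy)
    · rw [abs_of_nonneg (by positivity)]
      exact min_le_left _ _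
  let f : BoundedContinuousFunction (EuclideanSpace ℝ (Fin d)) ℝ :=
    .ofNormedAddCommGroup (fun x => r x - r 0) (by fun_prop) (Mr + Mr) fun x =>
      (norm_sub_le _ _).trans (add_le_add (hrbd x) (hrbd 0))
  have hf0 : f 0 = 0 := sub_self (r 0)
  have hf : Integrable f ν := integrable_of_le_norm_rpow hνlevy hνβ f.continuous.measurable hrH
    f.norm_coe_le_norm
  refine ⟨hf, (tendsto_inv_mul_integral_of_small_near_zero hν0 hmin hp hpν f hf0 hf
    fun ε hε => ?_).congr' ?_⟩
  · rcases hβ0.eq_or_lt with rfl | hβ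
    · have hone : Integrable (fun _ => (1 : ℝ)) ν :=
        integrable_of_le_norm_rpow hνlevy hνβ measurable_const (C := 1) (B := 1) (by simp) (by simp)
      have : IsFiniteMeasure ν := (integrable_const_iff_isFiniteMeasure one_ne_zero).1 hone
      exact small_near_zero_of_isFiniteMeasure hmin hp hpν f.continuous hf0 hε
    · have hminβ : Integrable (fun y => min 1 (‖y‖ ^ β)) ν := by
        refine integrable_of_le_norm_rpow hνlevy hνβ (by fun_prop) (C := 1) (B := 1)
          (fun y _ => ?_) fun y => ?_
        · rw [abs_of_nonneg (by positivity), one_mul]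
          exact min_le_right _ _
        · rw [abs_of_nonneg (by positivity)]
          exact min_le_left _ _
      exact small_near_zero_of_rpow hmin hp hpν hβ hβ1 hminβ hC hrH hε
  · filter_upwards [self_mem_nhdsWithin] with t ht
    have := hp t (le_of_lt ht)
    have hrint : Integrable r (p t) :=
      (integrable_const Mr).mono' hrc.aestronglyMeasurable (ae_of_all _ hrbd)
    simp only [f, BoundedContinuousFunction.coe_ofNormedAddCommGroup]
    rw [integral_sub hrint (integrable_const _)]
    simp
end

section
/- Let d ≥ 1, let 1 ≤ β < 2, and let ν be a symmetric Lévy measure on ℝ^d (ν(−G) = ν(G) for all Borel G) with ∫_{‖x‖<1} ‖x‖^β ν(dx) < ∞. Let (p_t)_{t≥0} be the marginal laws of the symmetric Lévy process with characteristic exponent ψ(ξ) = ∫ (1 − cos⟨ξ,y⟩) ν(dy) (triplet (0, 0, ν)). Let g be a bounded Borel function and μ a finite Borel measure on ℝ^d, and assume that r = g ∗ μ̌ is bounded and continuous and satisfies |r(x) + r(−x) − 2r(0)| ≤ C‖x‖^β for all x ∈ ℝ^d and some constant C > 0. Then lim_{t→0+} t^{−1}(H_g^μ(t) − H_g^μ(0))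 = (1/2) ∫_{ℝ^d} (r(x) + r(−x) − 2r(0)) ν(dx), the integral on the right being absolutely convergent. -/
open MeasureTheory Filter
open scoped Topology RealInnerProductSpace ENNReal

/-- `∑ aⁿ (1 - exp (-(2ⁿ s)² / 2))` is comparable to `aᴺ` when `2ᴺ s` is of order one. -/
lemma gaussian_scale_sum_bounds {a : ℝ} (ha0 : 0 < a) (ha1 : a < 1) (ha4 : 1 < 4 * a)
    {s S : ℝ} (hS : HasSum (fun n : ℕ => a ^ n * (1 - Real.exp (-((2 ^ n * s) ^ 2 / 2)))) S)
    {N : ℕ} (hs1 : (1 / 2) ^ (N + 1) ≤ s) (hs2 : s ≤ (1 / 2) ^ N) :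
    (1 - Real.exp (-(1 / 8))) * a ^ N ≤ S ∧
      S ≤ (2 * a / (4 * a - 1) + a / (1 - a)) * a ^ N := by
  have hs0 : 0 < s := lt_of_lt_of_le (by positivity) hs1
  have hterm : ∀ n : ℕ, 0 ≤ a ^ n * (1 - Real.exp (-((2 ^ n * s) ^ 2 / 2))) := fun n => by
    have : Real.exp (-((2 ^ n * s) ^ 2 / 2)) ≤ 1 := Real.exp_le_one_iff.2 (by
      have := sq_nonneg (2 ^ n * s); linarith)
    exact mul_nonneg (by positivity) (by linarith)
  constructor
  · have h1 : (1 : ℝ) / 2 ≤ 2 ^ N * s := by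
      calc (1 : ℝ) / 2 = 2 ^ N * (1 / 2) ^ (N + 1) := by
            rw [pow_succ, ← mul_assoc, ← mul_pow]; norm_num
        _ ≤ _ := by gcongr
    have h2 : Real.exp (-((2 ^ N * s) ^ 2 / 2)) ≤ Real.exp (-(1 / 8)) :=
      Real.exp_le_exp.2 (by nlinarith)
    calc _ ≤ a ^ N * (1 - Real.exp (-((2 ^ N * s) ^ 2 / 2))) := by
          rw [mul_comm]; gcongr
      _ ≤ S := le_hasSum hS N fun n _ => hterm n
  · rw [← hS.tsum_eq, ← hS.summable.sum_add_tsum_nat_add (N + 1), add_mul]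
    have h41 : 0 < 4 * a - 1 := by linarith
    have h1a : 0 < 1 - a := by linarith
    refine add_le_add ?_ ?_
    · have hsq : s ^ 2 ≤ (1 / 4) ^ N := by
        calc s ^ 2 ≤ ((1 / 2) ^ N) ^ 2 := by gcongr
          _ = (1 / 4) ^ N := by rw [← pow_mul, mul_comm, pow_mul]; norm_num
      calc ∑ n ∈ Finset.range (N + 1), a ^ n * (1 - Real.exp (-((2 ^ n * s) ^ 2 / 2)))
          ≤ ∑ n ∈ Finset.range (N + 1), (1 / 4) ^ N / 2 * (4 * a) ^ n := by
            refine Finset.sum_le_sum fun n _ => ?_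
            have h1 := Real.add_one_le_exp (-((2 ^ n * s) ^ 2 / 2))
            have h2 : (2 ^ n * s) ^ 2 = 4 ^ n * s ^ 2 := by
              rw [mul_pow, ← pow_mul, mul_comm n, pow_mul]; norm_num
            calc a ^ n * (1 - Real.exp (-((2 ^ n * s) ^ 2 / 2)))
                ≤ a ^ n * (4 ^ n * s ^ 2 / 2) := by
                  rw [h2] at h1 ⊢; gcongr; linarith
              _ ≤ a ^ n * (4 ^ n * (1 / 4) ^ N / 2) := by gcongr
              _ = _ := by rw [mul_pow]; ring
        _ = (1 / 4) ^ N / 2 * (((4 * a) ^ (N + 1) - 1) / (4 * a - 1)) := by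
            rw [← Finset.mul_sum, geom_sum_eq (by linarith)]
        _ ≤ (1 / 4) ^ N / 2 * ((4 * a) ^ (N + 1) / (4 * a - 1)) := by gcongr; linarith
        _ = 2 * a / (4 * a - 1) * a ^ N := by
            have : (1 / 4 : ℝ) ^ N * 4 ^ N = 1 := by rw [← mul_pow]; norm_num
            rw [mul_pow, pow_succ, pow_succ]
            linear_combination (2 * a / (4 * a - 1) * a ^ N) * this
    · have hg : HasSum (fun n : ℕ => a ^ (N + 1) * a ^ n) (a ^ (N + 1) * (1 - a)⁻¹) :=
        (hasSum_geometric_of_lt_one ha0.le ha1).mul_left _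
      have hle : ∀ n : ℕ, a ^ (n + (N + 1)) *
          (1 - Real.exp (-((2 ^ (n + (N + 1)) * s) ^ 2 / 2))) ≤ a ^ (N + 1) * a ^ n := fun n => by
        rw [← pow_add, add_comm n]
        have := Real.exp_pos (-((2 ^ (N + 1 + n) * s) ^ 2 / 2))
        exact mul_le_of_le_one_right (by positivity) (by linarith)
      calc ∑' n : ℕ, a ^ (n + (N + 1)) * (1 - Real.exp (-((2 ^ (n + (N + 1)) * s) ^ 2 / 2)))
          ≤ a ^ (N + 1) * (1 - a)⁻¹ :=
            hasSum_le hle ((summable_nat_add_iff (N + 1)).2 hS.summable).hasSum hg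
        _ = a / (1 - a) * a ^ N := by rw [pow_succ]; ring

section CosDefect

variable {E : Type*} [NormedAddCommGroup E] [InnerProductSpace ℝ E] [MeasurableSpace E]

/-- The exponent `x ↦ ∫ (1 - cos ⟪x, ξ⟫) dm(ξ)` of a measure `m`. -/
noncomputable def cosDefect (m : Measure E) (x : E) : ℝ := ∫ ξ, (1 - Real.cos ⟪x, ξ⟫) ∂m

lemma one_sub_cos_nonneg (a : ℝ) : 0 ≤ 1 - Real.cos a := by linarith [Real.cos_le_one a]

lemma one_sub_cos_le_two (a : ℝ) : 1 - Real.cos a ≤ 2 := by linarith [Real.neg_one_le_cos a]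

lemma abs_one_sub_cos_le_two (a : ℝ) : |1 - Real.cos a| ≤ 2 := by
  rw [abs_of_nonneg (one_sub_cos_nonneg a)]; exact one_sub_cos_le_two a

lemma cosDefect_nonneg (m : Measure E) (x : E) : 0 ≤ cosDefect m x :=
  integral_nonneg fun _ => one_sub_cos_nonneg _

@[simp] lemma cosDefect_zero (m : Measure E) : cosDefect m 0 = 0 := by simp [cosDefect]

@[simp] lemma cosDefect_neg (m : Measure E) (x : E) : cosDefect m (-x) = cosDefect m x := by
  simp [cosDefect]

variable [BorelSpace E]

lemma integrable_one_sub_cos (m : Measure E) [IsFiniteMeasure m] (x : E) :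
    Integrable (fun ξ => 1 - Real.cos ⟪x, ξ⟫) m :=
  Integrable.of_bound (Continuous.aestronglyMeasurable (by fun_prop)) 2
    (ae_of_all _ fun _ => abs_one_sub_cos_le_two _)

lemma cosDefect_le (m : Measure E) [IsFiniteMeasure m] (x : E) :
    cosDefect m x ≤ 2 * m.real Set.univ := by
  calc cosDefect m x ≤ ∫ _, (2 : ℝ) ∂m :=
        integral_mono (integrable_one_sub_cos m x) (integrable_const _)
          fun _ => one_sub_cos_le_two _
    _ = _ := by simp [mul_comm]

lemma continuous_cosDefect (m : Measure E) [IsFiniteMeasure m] : Continuous (cosDefect m) :=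
  continuous_of_dominated (bound := fun _ => 2)
    (fun _ => Continuous.aestronglyMeasurable (by fun_prop))
    (fun _ => ae_of_all _ fun _ => abs_one_sub_cos_le_two _) (integrable_const _)
    (ae_of_all _ fun _ => by fun_prop)

variable [FiniteDimensional ℝ E]

lemma integral_cos_stdGaussian (x : E) (c : ℝ) :
    ∫ ξ, Real.cos ⟪x, ξ⟫ ∂((ProbabilityTheory.stdGaussian E).map (c • ·)) =
      Real.exp (-((c * ‖x‖) ^ 2 / 2)) := by
  have h := charFun_map_smul (μ := ProbabilityTheory.stdGaussian E) c x
  rw [ProbabilityTheory.charFun_stdGaussian] at h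
  have hprob : IsProbabilityMeasure ((ProbabilityTheory.stdGaussian E).map (c • ·)) :=
    Measure.isProbabilityMeasure_map (by fun_prop)
  have hint : Integrable (fun ξ => Complex.exp (⟪ξ, x⟫ * Complex.I))
      ((ProbabilityTheory.stdGaussian E).map (c • ·)) :=
    Integrable.of_bound (Continuous.aestronglyMeasurable (by fun_prop)) 1
      (ae_of_all _ fun _ => (Complex.norm_exp_ofReal_mul_I _).le)
  have h2 := congrArg Complex.re h
  rw [charFun_apply, ← RCLike.re_eq_complex_re, ← integral_re hint] at h2
  simp only [RCLike.re_eq_complex_re, Complex.exp_ofReal_mul_I_re] at h2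
  simp_rw [real_inner_comm x] at h2
  rw [h2, norm_smul]
  have : (-((‖c‖ * ‖x‖ : ℝ) : ℂ) ^ 2 / 2) = ((-((c * ‖x‖) ^ 2 / 2) : ℝ) : ℂ) := by
    rw [mul_pow c, ← sq_abs c]
    push_cast
    rw [Real.norm_eq_abs]
    ring
  rw [this, ← Complex.ofReal_exp, Complex.ofReal_re]

variable (E) in
/-- A finite mixture of centred Gaussians whose exponent is comparable to `‖x‖ ^ β` near `0`. -/
noncomputable def gaussianMixture (β : ℝ) : Measure E :=
  Measure.sum fun n : ℕ => ENNReal.ofReal (((2 : ℝ) ^ (-β)) ^ n) •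
    (ProbabilityTheory.stdGaussian E).map ((2 : ℝ) ^ n • ·)

lemma two_rpow_neg_lt_one {β : ℝ} (hβ : 0 < β) : (2 : ℝ) ^ (-β) < 1 :=
  Real.rpow_lt_one_of_one_lt_of_neg (by norm_num) (by linarith)

lemma isFiniteMeasure_gaussianMixture {β : ℝ} (hβ : 0 < β) :
    IsFiniteMeasure (gaussianMixture E β) := by
  have hprob : ∀ n : ℕ,
      IsProbabilityMeasure ((ProbabilityTheory.stdGaussian E).map ((2 : ℝ) ^ n • ·)) :=
    fun n => Measure.isProbabilityMeasure_map (by fun_prop)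
  refine ⟨?_⟩
  simp only [gaussianMixture, Measure.sum_apply _ MeasurableSet.univ, Measure.smul_apply,
    measure_univ, smul_eq_mul, mul_one]
  exact (summable_geometric_of_lt_one (by positivity) (two_rpow_neg_lt_one hβ)).tsum_ofReal_lt_top

lemma hasSum_cosDefect_gaussianMixture {β : ℝ} (hβ : 0 < β) (x : E) :
    HasSum (fun n : ℕ => ((2 : ℝ) ^ (-β)) ^ n * (1 - Real.exp (-((2 ^ n * ‖x‖) ^ 2 / 2))))
      (cosDefect (gaussianMixture E β) x) := by
  have := isFiniteMeasure_gaussianMixture (E := E) hβ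
  have h := hasSum_integral_measure (integrable_one_sub_cos (gaussianMixture E β) x)
  convert! h using 2 with n
  have hprob : IsProbabilityMeasure ((ProbabilityTheory.stdGaussian E).map ((2 : ℝ) ^ n • ·)) :=
    Measure.isProbabilityMeasure_map (by fun_prop)
  rw [integral_smul_measure, integral_sub (integrable_const _), integral_cos_stdGaussian,
    ENNReal.toReal_ofReal (by positivity)]
  · simp
  · exact Integrable.of_bound (Continuous.aestronglyMeasurable (by fun_prop)) 1
      (ae_of_all _ fun _ => Real.abs_cos_le_one _)

lemma cosDefect_gaussianMixture_bounds {β : ℝ} (hβ0 : 0 < β) (hβ2 : β < 2) :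
    ∃ c K : ℝ, 0 < c ∧ 0 ≤ K ∧ (∀ x : E, ‖x‖ < 1 →
        c * ‖x‖ ^ β ≤ cosDefect (gaussianMixture E β) x ∧
        cosDefect (gaussianMixture E β) x ≤ K * ‖x‖ ^ β) ∧
      ∀ x : E, 1 ≤ ‖x‖ → c ≤ cosDefect (gaussianMixture E β) x := by
  set a : ℝ := (2 : ℝ) ^ (-β) with ha
  have ha0 : 0 < a := by positivity
  have ha1 : a < 1 := two_rpow_neg_lt_one hβ0
  have ha4 : 1 < 4 * a := by
    have : (4 : ℝ) * a = 2 ^ (2 - β) := by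
      rw [sub_eq_add_neg, Real.rpow_add (by norm_num), ha]; norm_num
    rw [this]
    exact Real.one_lt_rpow (by norm_num) (by linarith)
  have h41 : 0 < 4 * a - 1 := by linarith
  have h1a : 0 < 1 - a := by linarith
  have hc : 0 < 1 - Real.exp (-(1 / 8)) := by
    have : Real.exp (-(1 / 8)) < 1 := Real.exp_zero ▸ Real.exp_lt_exp.2 (by norm_num)
    linarith
  have hpow : ∀ n : ℕ, ((1 / 2 : ℝ) ^ n) ^ β = a ^ n := fun n => by
    rw [ha, Real.rpow_neg (by norm_num), ← Real.inv_rpow (by norm_num), ← one_div,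
      ← Real.rpow_natCast, ← Real.rpow_natCast, ← Real.rpow_mul (by norm_num),
      ← Real.rpow_mul (by norm_num), mul_comm]
  set K := 2 * a / (4 * a - 1) + a / (1 - a)
  have hK : 0 ≤ K := by positivity
  refine ⟨1 - Real.exp (-(1 / 8)), K / a, hc, by positivity, fun x hx => ?_, fun x hx => ?_⟩
  · rcases eq_or_ne x 0 with rfl | hx0
    · simp [Real.zero_rpow hβ0.ne']
    obtain ⟨N, hN1, hN2⟩ := exists_nat_pow_near_of_lt_one (norm_pos_iff.2 hx0) hx.le
      (by norm_num : (0 : ℝ) < 1 / 2) (by norm_num)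
    obtain ⟨h1, h2⟩ := gaussian_scale_sum_bounds ha0 ha1 ha4
      (hasSum_cosDefect_gaussianMixture hβ0 x) hN1.le hN2
    constructor
    · refine le_trans ?_ h1
      rw [← hpow]
      gcongr
    · refine h2.trans ?_
      have : a ^ (N + 1) ≤ ‖x‖ ^ β := by
        rw [← hpow]
        gcongr
      calc K * a ^ N = K / a * a ^ (N + 1) := by rw [pow_succ]; field_simp
        _ ≤ _ := by gcongr
  · have hS := hasSum_cosDefect_gaussianMixture hβ0 x
    have h0 := le_hasSum hS 0 fun n _ => mul_nonneg (by positivity) (sub_nonneg.2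
      (Real.exp_le_one_iff.2 (by have := sq_nonneg (2 ^ n * ‖x‖); linarith)))
    refine le_trans ?_ h0
    simp only [pow_zero, one_mul]
    gcongr
    · nlinarith
    · norm_num

end CosDefect

section Symmetric

variable {E : Type*} [NormedAddCommGroup E] [InnerProductSpace ℝ E] [MeasurableSpace E]
  [BorelSpace E]

lemma sigmaFinite_of_lintegral_lt_top {X : Type*} [MeasurableSpace X] {ν : Measure X}
    {f : X → ℝ≥0∞} (hf : Measurable f) (hint : ∫⁻ x, f x ∂ν < ⊤) (h0 : ν {x | f x = 0} = 0) :
    SigmaFinite ν := by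
  refine ⟨⟨fun n : ℕ => {x | f x = 0} ∪ {x | ((n : ℝ≥0∞) + 1)⁻¹ ≤ f x}, fun _ => trivial,
    fun n => ?_, ?_⟩⟩
  · refine (measure_union_le _ _).trans_lt (ENNReal.add_lt_top.2 ⟨by simp [h0], ?_⟩)
    refine (meas_ge_le_lintegral_div hf.aemeasurable (by simp) (by simp)).trans_lt ?_
    exact ENNReal.div_lt_top hint.ne (by simp)
  · refine Set.eq_univ_of_forall fun x => Set.mem_iUnion.2 ?_
    rcases eq_or_ne (f x) 0 with hx | hx
    · exact ⟨0, Or.inl hx⟩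
    · obtain ⟨n, hn⟩ := ENNReal.exists_inv_nat_lt hx
      refine ⟨n, Or.inr (le_trans ?_ hn.le)⟩
      exact ENNReal.inv_le_inv.2 le_self_add

omit [InnerProductSpace ℝ E] in
lemma integral_eq_zero_of_odd {P : Measure E} (hP : P.map (fun x => -x) = P) {F : E → ℝ}
    (hF : ∀ x, F (-x) = -F x) : ∫ x, F x ∂P = 0 := by
  have h : ∫ x, F x ∂P = ∫ x, F (-x) ∂P := by
    conv_lhs => rw [← hP]
    exact integral_map_equiv (MeasurableEquiv.neg E) F
  simp only [hF, integral_neg] at h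
  linarith

omit [InnerProductSpace ℝ E] in
lemma integral_comp_neg_of_symm {P : Measure E} (hP : P.map (fun x => -x) = P) (F : E → ℝ) :
    ∫ x, F (-x) ∂P = ∫ x, F x ∂P := by
  conv_rhs => rw [← hP]
  exact (integral_map_equiv (MeasurableEquiv.neg E) F).symm

lemma charFun_withDensity_of_symm {P : Measure E} (hP : P.map (fun x => -x) = P)
    {h : E → ℝ} (hh : Integrable h P) (hm : Measurable h) (h0 : ∀ x, 0 ≤ h x)
    (heven : ∀ x, h (-x) = h x) (η : E) :
    charFun (P.withDensity fun x => ENNReal.ofReal (h x)) η =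
      ((∫ x, h x * Real.cos ⟪η, x⟫ ∂P : ℝ) : ℂ) := by
  rw [charFun_apply, integral_withDensity_eq_integral_toReal_smul hm.ennreal_ofReal (by simp)]
  simp only [ENNReal.toReal_ofReal (h0 _)]
  have hint : Integrable (fun x => h x • Complex.exp (⟪x, η⟫ * Complex.I)) P :=
    hh.smul_bdd 1 (Continuous.aestronglyMeasurable (by fun_prop))
      (ae_of_all _ fun _ => (Complex.norm_exp_ofReal_mul_I _).le)
  apply Complex.ext
  · rw [← RCLike.re_eq_complex_re, ← integral_re hint]
    simp [Complex.exp_ofReal_mul_I_re, real_inner_comm η]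
  · rw [← RCLike.im_eq_complex_im, ← integral_im hint]
    simp only [RCLike.im_eq_complex_im, Complex.smul_im, Complex.exp_ofReal_mul_I_im,
      Complex.ofReal_im]
    exact integral_eq_zero_of_odd hP fun x => by simp [heven]

end Symmetric

section Exponent

variable {E : Type*} [NormedAddCommGroup E] [InnerProductSpace ℝ E] [MeasurableSpace E]
  [BorelSpace E] [SecondCountableTopology E]

lemma integrable_prod_one_sub_cos {P m : Measure E} [SFinite P] [IsFiniteMeasure m]
    (hP : Integrable (cosDefect m) P) :
    Integrable (fun z : E × E => 1 - Real.cos ⟪z.1, z.2⟫) (P.prod m) := by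
  refine (integrable_prod_iff (Continuous.aestronglyMeasurable (by fun_prop))).2
    ⟨ae_of_all _ fun x => integrable_one_sub_cos m x, ?_⟩
  simp only [Real.norm_eq_abs, abs_of_nonneg (one_sub_cos_nonneg _)]
  exact hP

lemma integrable_cosDefect_swap {P m : Measure E} [SFinite P] [IsFiniteMeasure m]
    (hP : Integrable (cosDefect m) P) : Integrable (cosDefect P) m := by
  have h := (integrable_prod_one_sub_cos hP).integral_prod_right
  simp only [real_inner_comm] at h
  exact h

lemma measurable_cosDefect (P : Measure E) [SFinite P] : Measurable (cosDefect P) := by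
  have h : StronglyMeasurable (Function.uncurry fun x ξ : E => 1 - Real.cos ⟪x, ξ⟫) :=
    Continuous.stronglyMeasurable (by unfold Function.uncurry; fun_prop)
  exact h.integral_prod_right.measurable

/-- Fubini together with the product formula for cosines. -/
lemma integral_cosDefect_mul_cos {P m : Measure E} [SFinite P] [IsFiniteMeasure m]
    (hP : Integrable (cosDefect m) P)
    (hcos : ∀ ξ : E, Integrable (fun x => 1 - Real.cos ⟪ξ, x⟫) P) (η : E) :
    ∫ x, cosDefect m x * Real.cos ⟪η, x⟫ ∂P =
      ∫ ξ, (cosDefect P (η + ξ) / 2 + cosDefect P (η - ξ) / 2 - cosDefect P η) ∂m := by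
  have hprod : Integrable (Function.uncurry fun x ξ : E =>
      (1 - Real.cos ⟪x, ξ⟫) * Real.cos ⟪η, x⟫) (P.prod m) :=
    (integrable_prod_one_sub_cos hP).mul_bdd (c := 1) (g := fun z : E × E => Real.cos ⟪η, z.1⟫)
      (Continuous.aestronglyMeasurable (by fun_prop))
      (ae_of_all _ fun _ => Real.abs_cos_le_one _)
  simp_rw [cosDefect, ← integral_mul_const]
  rw [integral_integral_swap hprod]
  congr 1 with ξ
  have hadd : Integrable (fun x => (1 - Real.cos ⟪η + ξ, x⟫) / 2 +
      (1 - Real.cos ⟪η - ξ, x⟫) / 2) P := ((hcos _).div_const _).add ((hcos _).div_const _)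
  rw [← integral_div, ← integral_div, ← integral_add ((hcos _).div_const _)
    ((hcos _).div_const _), ← integral_sub hadd (hcos _)]
  congr 1 with x
  rw [inner_add_left, inner_sub_left, Real.cos_add, Real.cos_sub, real_inner_comm x ξ]
  ring

lemma one_sub_cos_add_le (a b : ℝ) :
    1 - Real.cos (a + b) ≤ 2 * (1 - Real.cos a) + 2 * (1 - Real.cos b) := by
  have h : ∀ u : ℝ, 1 - Real.cos u = 2 * Real.sin (u / 2) ^ 2 := fun u => by
    have := Real.cos_two_mul (u / 2)
    rw [mul_div_cancel₀ u two_ne_zero] at this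
    linarith [Real.sin_sq_add_cos_sq (u / 2)]
  rw [h, h, h, add_div, Real.sin_add]
  set s := Real.sin (a / 2)
  set s' := Real.sin (b / 2)
  have hs : Real.cos (a / 2) ^ 2 ≤ 1 := Real.cos_sq_le_one _
  have hs' : Real.cos (b / 2) ^ 2 ≤ 1 := Real.cos_sq_le_one _
  nlinarith [sq_nonneg (s * Real.cos (b / 2) - Real.cos (a / 2) * s'),
    mul_le_mul_of_nonneg_left hs' (sq_nonneg s), mul_le_mul_of_nonneg_left hs (sq_nonneg s')]

omit [BorelSpace E] [SecondCountableTopology E] in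
lemma cosDefect_add_le {P : Measure E}
    (hcos : ∀ ξ : E, Integrable (fun x => 1 - Real.cos ⟪ξ, x⟫) P) (η ξ : E) :
    cosDefect P (η + ξ) ≤ 2 * cosDefect P η + 2 * cosDefect P ξ := by
  simp only [cosDefect]
  rw [← integral_const_mul, ← integral_const_mul, ← integral_add ((hcos _).const_mul _)
    ((hcos _).const_mul _)]
  refine integral_mono (hcos _) (((hcos _).const_mul _).add ((hcos _).const_mul _)) fun x => ?_
  simp only [inner_add_left]
  exact one_sub_cos_add_le _ _

lemma tendsto_inv_mul_one_sub_exp_s1 (c : ℝ) :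
    Tendsto (fun t : ℝ => t⁻¹ * (1 - Real.exp (-(t * c)))) (𝓝[>] 0) (𝓝 c) := by
  have h : HasDerivAt (fun t : ℝ => 1 - Real.exp (-(t * c))) c 0 := by
    have := (((hasDerivAt_id (0 : ℝ)).mul_const c).neg.exp).const_sub 1
    simpa using this
  have h2 := h.tendsto_slope_zero_right
  simpa using h2

lemma abs_inv_mul_one_sub_exp_le {t c : ℝ} (ht : 0 < t) (hc : 0 ≤ c) :
    |t⁻¹ * (1 - Real.exp (-(t * c)))| ≤ c := by
  have h1 : Real.exp (-(t * c)) ≤ 1 := Real.exp_le_one_iff.2 (by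
    have := mul_nonneg ht.le hc; linarith)
  have h2 := Real.add_one_le_exp (-(t * c))
  rw [abs_of_nonneg (mul_nonneg (by positivity) (by linarith)), inv_mul_le_iff₀ ht]
  linarith

lemma tendsto_integral_cosDefect_mul_cos {ν m : Measure E} [SFinite ν] [IsFiniteMeasure m]
    (hν : Integrable (cosDefect m) ν)
    (hcos : ∀ ξ : E, Integrable (fun x => 1 - Real.cos ⟪ξ, x⟫) ν)
    {p : ℝ → Measure E} (hp : ∀ t, 0 ≤ t → IsProbabilityMeasure (p t))
    (hexp : ∀ t, 0 ≤ t → ∀ ξ, cosDefect (p t) ξ = 1 - Real.exp (-(t * cosDefect ν ξ))) (η : E) :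
    Tendsto (fun t : ℝ => t⁻¹ * ∫ x, cosDefect m x * Real.cos ⟪η, x⟫ ∂(p t)) (𝓝[>] 0)
      (𝓝 (∫ x, cosDefect m x * Real.cos ⟪η, x⟫ ∂ν)) := by
  set ψ := cosDefect ν with hψ
  have hψ0 : ∀ ξ, 0 ≤ ψ ξ := cosDefect_nonneg ν
  have hψm : Measurable ψ := measurable_cosDefect ν
  have hψi : Integrable ψ m := integrable_cosDefect_swap hν
  have hdom : Integrable (fun ξ => 2 * ψ η + 2 * ψ ξ) m :=
    (integrable_const _).add (hψi.const_mul 2)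
  have hplus : ∀ ξ, ψ (η + ξ) ≤ 2 * ψ η + 2 * ψ ξ := cosDefect_add_le hcos η
  have hminus : ∀ ξ, ψ (η - ξ) ≤ 2 * ψ η + 2 * ψ ξ := fun ξ => by
    simpa [sub_eq_add_neg, hψ] using cosDefect_add_le hcos η (-ξ)
  rw [integral_cosDefect_mul_cos hν hcos]
  have key : Tendsto (fun t : ℝ => ∫ ξ, (t⁻¹ * (1 - Real.exp (-(t * ψ (η + ξ)))) / 2 +
      t⁻¹ * (1 - Real.exp (-(t * ψ (η - ξ)))) / 2 - t⁻¹ * (1 - Real.exp (-(t * ψ η)))) ∂m)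
      (𝓝[>] 0) (𝓝 (∫ ξ, (ψ (η + ξ) / 2 + ψ (η - ξ) / 2 - ψ η) ∂m)) := by
    refine tendsto_integral_filter_of_dominated_convergence
      (fun ξ => (2 * ψ η + 2 * ψ ξ) + ψ η) ?_ ?_ (hdom.add (integrable_const _)) ?_
    · exact Eventually.of_forall fun t => Measurable.aestronglyMeasurable (by fun_prop)
    · filter_upwards [self_mem_nhdsWithin] with t ht
      refine ae_of_all _ fun ξ => ?_
      have h1 := abs_le.1 (abs_inv_mul_one_sub_exp_le ht (hψ0 (η + ξ)))
      have h2 := abs_le.1 (abs_inv_mul_one_sub_exp_le ht (hψ0 (η - ξ)))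
      have h3 := abs_le.1 (abs_inv_mul_one_sub_exp_le ht (hψ0 η))
      rw [Real.norm_eq_abs, abs_le]
      constructor <;> linarith [hplus ξ, hminus ξ]
    · refine ae_of_all _ fun ξ => ?_
      exact (((tendsto_inv_mul_one_sub_exp_s1 _).div_const 2).add
        ((tendsto_inv_mul_one_sub_exp_s1 _).div_const 2)).sub (tendsto_inv_mul_one_sub_exp_s1 _)
  refine key.congr' ?_
  filter_upwards [self_mem_nhdsWithin] with t ht
  have := hp t (le_of_lt ht)
  rw [integral_cosDefect_mul_cos _ (integrable_one_sub_cos (p t)), ← integral_const_mul]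
  · simp only [hexp t (le_of_lt ht)]
    congr 1 with ξ
    ring
  · refine Integrable.of_bound (continuous_cosDefect m).aestronglyMeasurable
      (2 * m.real Set.univ) (ae_of_all _ fun x => ?_)
    rw [Real.norm_eq_abs, abs_of_nonneg (cosDefect_nonneg m x)]
    exact cosDefect_le m x

end Exponent

section WeakConvergence

variable {E : Type*} [NormedAddCommGroup E] [MeasurableSpace E] [BorelSpace E]

/-- The probability measure obtained by normalizing `μ + δ₀`. -/
noncomputable def normalizedAddDirac (μ : Measure E) : Measure E :=
  (μ Set.univ + 1)⁻¹ • (μ + Measure.dirac 0)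

instance (μ : Measure E) [IsFiniteMeasure μ] : IsProbabilityMeasure (normalizedAddDirac μ) := by
  refine ⟨?_⟩
  simp only [normalizedAddDirac, Measure.smul_apply, Measure.add_apply, measure_univ, smul_eq_mul]
  exact ENNReal.inv_mul_cancel (by simp) (by simp)

lemma integral_normalizedAddDirac {F : Type*} [NormedAddCommGroup F] [NormedSpace ℝ F]
    [CompleteSpace F] (μ : Measure E) [IsFiniteMeasure μ] {f : E → F} (hf : Integrable f μ) :
    ∫ x, f x ∂(normalizedAddDirac μ) = (μ.real Set.univ + 1)⁻¹ • (∫ x, f x ∂μ + f 0) := by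
  rw [normalizedAddDirac, integral_smul_measure, integral_add_measure hf
    (integrable_dirac (by simp)), integral_dirac, ENNReal.toReal_inv,
    ENNReal.toReal_add (measure_ne_top _ _) (by simp), ENNReal.toReal_one, Measure.real]

variable [InnerProductSpace ℝ E]

lemma charFun_normalizedAddDirac (μ : Measure E) [IsFiniteMeasure μ] (η : E) :
    charFun (normalizedAddDirac μ) η = (μ.real Set.univ + 1)⁻¹ • (charFun μ η + 1) := by
  rw [charFun_apply, integral_normalizedAddDirac, charFun_apply]
  · simp
  · exact Integrable.of_bound (Continuous.aestronglyMeasurable (by fun_prop)) 1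
      (ae_of_all _ fun _ => (Complex.norm_exp_ofReal_mul_I _).le)

variable [FiniteDimensional ℝ E]

/-- Lévy's convergence theorem for finite measures. -/
lemma tendsto_integral_of_tendsto_charFun {κs : ℕ → Measure E} {κ : Measure E}
    [∀ n, IsFiniteMeasure (κs n)] [IsFiniteMeasure κ]
    (h : ∀ η, Tendsto (fun n => charFun (κs n) η) atTop (𝓝 (charFun κ η)))
    {φ : E → ℝ} (hφ : Continuous φ) {M : ℝ} (hM : ∀ x, |φ x| ≤ M) :
    Tendsto (fun n => ∫ x, φ x ∂(κs n)) atTop (𝓝 (∫ x, φ x ∂κ)) := by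
  have hmass : Tendsto (fun n => (κs n).real Set.univ) atTop (𝓝 (κ.real Set.univ)) := by
    have := (Complex.continuous_re.tendsto _).comp (h 0)
    simpa [Function.comp_def] using this
  have hpos : κ.real Set.univ + 1 ≠ 0 := by positivity
  let P : ℕ → ProbabilityMeasure E := fun n => ⟨normalizedAddDirac (κs n), inferInstance⟩
  let Q : ProbabilityMeasure E := ⟨normalizedAddDirac κ, inferInstance⟩
  have hPQ : Tendsto P atTop (𝓝 Q) := by
    refine ProbabilityMeasure.tendsto_of_tendsto_charFun fun η => ?_
    simp only [P, Q, ProbabilityMeasure.coe_mk, charFun_normalizedAddDirac]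
    exact ((hmass.add_const 1).inv₀ hpos).smul ((h η).add_const 1)
  have hint : ∀ μ : Measure E, IsFiniteMeasure μ → Integrable φ μ := fun μ _ =>
    Integrable.of_bound hφ.aestronglyMeasurable M (ae_of_all _ hM)
  have hlim := ProbabilityMeasure.tendsto_iff_forall_integral_tendsto.1 hPQ
    (BoundedContinuousFunction.ofNormedAddCommGroup φ hφ M hM)
  simp only [P, Q, ProbabilityMeasure.coe_mk, BoundedContinuousFunction.coe_ofNormedAddCommGroup,
    integral_normalizedAddDirac _ (hint _ inferInstance)] at hlim
  have := ((hmass.add_const 1).smul hlim).sub_const (φ 0)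
  have hcancel : ∀ (μ : Measure E) (I : ℝ),
      (μ.real Set.univ + 1) • (μ.real Set.univ + 1)⁻¹ • (I + φ 0) - φ 0 = I := fun μ I => by
    rw [smul_inv_smul₀ (by positivity)]; ring
  simpa only [hcancel] using this

/-- Convergence of integrals extends to bounded functions continuous off a null point. -/
lemma tendsto_integral_of_tendsto_charFun_of_continuousAt {κs : ℕ → Measure E} {κ : Measure E}
    [∀ n, IsFiniteMeasure (κs n)] [IsFiniteMeasure κ]
    (h : ∀ η, Tendsto (fun n => charFun (κs n) η) atTop (𝓝 (charFun κ η))) (hκ0 : κ {0} = 0)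
    {φ : E → ℝ} (hφm : Measurable φ) (hφ : ∀ x, x ≠ 0 → ContinuousAt φ x)
    {M : ℝ} (hM : ∀ x, |φ x| ≤ M) :
    Tendsto (fun n => ∫ x, φ x ∂(κs n)) atTop (𝓝 (∫ x, φ x ∂κ)) := by
  have hM0 : 0 ≤ M := (abs_nonneg _).trans (hM 0)
  let χ : ℕ → E → ℝ := fun k x => min 1 (k * ‖x‖)
  have hχc : ∀ k, Continuous (χ k) := fun k => by fun_prop
  have hχ0 : ∀ k x, 0 ≤ χ k x := fun k x => le_min zero_le_one (by positivity)
  have hχ1 : ∀ k x, χ k x ≤ 1 := fun k x => min_le_left _ _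
  have hψc : ∀ k, Continuous fun x => M * (1 - χ k x) := fun k => by fun_prop
  have hψb : ∀ k x, |M * (1 - χ k x)| ≤ M := fun k x => by
    rw [abs_of_nonneg (mul_nonneg hM0 (by linarith [hχ1 k x]))]
    exact mul_le_of_le_one_right hM0 (by linarith [hχ0 k x])
  have hφχb : ∀ k x, |φ x * χ k x| ≤ M := fun k x => by
    rw [abs_mul, abs_of_nonneg (hχ0 k x)]
    exact (mul_le_of_le_one_right (abs_nonneg _) (hχ1 k x)).trans (hM x)
  have hφχc : ∀ k, Continuous fun x => φ x * χ k x := fun k => by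
    refine continuous_iff_continuousAt.2 fun x => ?_
    rcases eq_or_ne x 0 with rfl | hx
    · have h0 : Tendsto (fun x => M * χ k x) (𝓝 0) (𝓝 0) := by
        have := ((hχc k).const_mul M).tendsto 0
        simpa [χ] using this
      have : φ 0 * χ k 0 = 0 := by simp [χ]
      rw [ContinuousAt, this]
      refine squeeze_zero_norm (fun x => ?_) h0
      rw [norm_mul, Real.norm_of_nonneg (hχ0 k x)]
      exact mul_le_mul_of_nonneg_right (hM x) (hχ0 k x)
    · exact (hφ x hx).mul (hχc k).continuousAt
  have hdiff : ∀ (μ : Measure E) [IsFiniteMeasure μ] (k : ℕ),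
      |∫ x, φ x ∂μ - ∫ x, φ x * χ k x ∂μ| ≤ ∫ x, M * (1 - χ k x) ∂μ := fun μ _ k => by
    rw [← integral_sub (Integrable.of_bound hφm.aestronglyMeasurable M (ae_of_all _ hM))
      (Integrable.of_bound (hφχc k).aestronglyMeasurable M (ae_of_all _ (hφχb k)))]
    refine norm_integral_le_of_norm_le (f := fun x => φ x - φ x * χ k x)
      (Integrable.of_bound (hψc k).aestronglyMeasurable M (ae_of_all _ (hψb k)))
      (ae_of_all _ fun x => ?_)
    have : φ x - φ x * χ k x = φ x * (1 - χ k x) := by ring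
    rw [this, norm_mul, Real.norm_of_nonneg (show 0 ≤ 1 - χ k x by linarith [hχ1 k x])]
    exact mul_le_mul_of_nonneg_right (hM x) (by linarith [hχ1 k x])
  have hsmall : Tendsto (fun k => ∫ x, M * (1 - χ k x) ∂κ) atTop (𝓝 0) := by
    have : Tendsto (fun k => ∫ x, M * (1 - χ k x) ∂κ) atTop (𝓝 (∫ _, (0 : ℝ) ∂κ)) := by
      refine tendsto_integral_of_dominated_convergence (fun _ => M)
        (fun k => (hψc k).aestronglyMeasurable) (integrable_const _)
        (fun k => ae_of_all _ (hψb k)) ?_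
      have hne : ∀ᵐ x ∂κ, x ≠ 0 := measure_eq_zero_iff_ae_notMem.1 hκ0
      filter_upwards [hne] with x hx
      refine tendsto_const_nhds.congr' ?_
      obtain ⟨K, hK⟩ := exists_nat_gt ‖x‖⁻¹
      filter_upwards [eventually_ge_atTop K] with k hk
      have hx0 : 0 < ‖x‖ := norm_pos_iff.2 hx
      have : 1 ≤ k * ‖x‖ := by
        rw [← inv_le_iff_one_le_mul₀ hx0]
        exact hK.le.trans (by exact_mod_cast hk)
      simp [χ, min_eq_left this]
    simpa using this
  refine Metric.tendsto_atTop'.2 fun ε hε => ?_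
  obtain ⟨k, hk⟩ := (hsmall.eventually_lt_const (show 0 < ε / 3 by positivity)).exists
  have h1 := (tendsto_integral_of_tendsto_charFun h (hψc k) (hψb k)).eventually_lt_const hk
  have h2 := (Metric.tendsto_nhds.1
    (tendsto_integral_of_tendsto_charFun h (hφχc k) (hφχb k))) (ε / 3) (by positivity)
  obtain ⟨N, hN⟩ := eventually_atTop.1 (h1.and h2)
  refine ⟨N, fun n hn => ?_⟩
  obtain ⟨hn1, hn2⟩ := hN n hn.le
  rw [Real.dist_eq, abs_lt] at hn2 ⊢
  have h3 := abs_le.1 (hdiff (κs n) k)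
  have h4 := abs_le.1 (hdiff κ k)
  constructor <;> linarith

end WeakConvergence

section SmallTime

variable {E : Type*} [NormedAddCommGroup E] [InnerProductSpace ℝ E] [MeasurableSpace E]
  [BorelSpace E] [FiniteDimensional ℝ E]

/-- Small-time limit of `t⁻¹ p_t` tested against functions dominated by the exponent of a finite
measure. -/
lemma tendsto_inv_mul_integral_of_le_cosDefect {ν m : Measure E} [SFinite ν] [IsFiniteMeasure m]
    (hν : Integrable (cosDefect m) ν) (hνsym : ν.map (fun x => -x) = ν)
    (hcos : ∀ ξ : E, Integrable (fun x => 1 - Real.cos ⟪ξ, x⟫) ν)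
    {p : ℝ → Measure E} (hp : ∀ t, 0 ≤ t → IsProbabilityMeasure (p t))
    (hpsym : ∀ t, 0 ≤ t → (p t).map (fun x => -x) = p t)
    (hexp : ∀ t, 0 ≤ t → ∀ ξ, cosDefect (p t) ξ = 1 - Real.exp (-(t * cosDefect ν ξ)))
    (hpos : ∀ x, x ≠ 0 → 0 < cosDefect m x) {f : E → ℝ} (hf : Continuous f) {K : ℝ}
    (hfK : ∀ x, |f x| ≤ K * cosDefect m x) :
    Tendsto (fun t : ℝ => t⁻¹ * ∫ x, f x ∂(p t)) (𝓝[>] 0) (𝓝 (∫ x, f x ∂ν)) := by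
  set h := cosDefect m with hh
  have hc : Continuous h := continuous_cosDefect m
  have h0 : ∀ x, 0 ≤ h x := cosDefect_nonneg m
  have hf0 : ∀ x, f x / h x * h x = f x := fun x => by
    rcases eq_or_ne x 0 with rfl | hx
    · have := hfK 0
      simp only [hh, cosDefect_zero, mul_zero] at this ⊢
      exact (abs_nonpos_iff.1 this).symm
    · exact div_mul_cancel₀ _ (hpos x hx).ne'
  have hφb : ∀ x, |f x / h x| ≤ |K| := fun x => by
    rw [abs_div, abs_of_nonneg (h0 x)]
    exact div_le_of_le_mul₀ (h0 x) (abs_nonneg _)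
      ((hfK x).trans (mul_le_mul_of_nonneg_right (le_abs_self K) (h0 x)))
  have hwd : ∀ {P : Measure E} {w : E → ℝ}, Measurable w → (∀ x, 0 ≤ w x) →
      ∫ x, f x / h x ∂(P.withDensity fun x => ENNReal.ofReal (w x)) =
        ∫ x, w x * (f x / h x) ∂P := fun hw hw0 => by
    rw [integral_withDensity_eq_integral_toReal_smul hw.ennreal_ofReal (by simp)]
    simp [ENNReal.toReal_ofReal (hw0 _)]
  refine tendsto_of_seq_tendsto fun u hu => ?_
  obtain ⟨hu0, hupos⟩ := tendsto_nhdsWithin_iff.1 hu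
  obtain ⟨N, hN⟩ := eventually_atTop.1 hupos
  rw [← tendsto_add_atTop_iff_nat N]
  set v : ℕ → ℝ := fun n => u (n + N) with hv
  have hvpos : ∀ n, 0 < v n := fun n => hN _ (Nat.le_add_left _ _)
  have hvlim : Tendsto v atTop (𝓝[>] 0) := hu.comp (tendsto_add_atTop_nat N)
  have hhb : ∀ n, Integrable (fun x => (v n)⁻¹ * h x) (p (v n)) := fun n => by
    have := hp _ (hvpos n).le
    refine Integrable.const_mul (Integrable.of_bound hc.aestronglyMeasurable
      (2 * m.real Set.univ) (ae_of_all _ fun x => ?_)) _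
    rw [Real.norm_of_nonneg (h0 x)]
    exact cosDefect_le m x
  have hw0 : ∀ n x, 0 ≤ (v n)⁻¹ * h x := fun n x =>
    mul_nonneg (inv_nonneg.2 (hvpos n).le) (h0 x)
  have hwm : ∀ n, Measurable fun x => (v n)⁻¹ * h x := fun n => by fun_prop
  let κs : ℕ → Measure E := fun n =>
    (p (v n)).withDensity fun x => ENNReal.ofReal ((v n)⁻¹ * h x)
  let κ : Measure E := ν.withDensity fun x => ENNReal.ofReal (h x)
  have hκs : ∀ n, IsFiniteMeasure (κs n) := fun n => isFiniteMeasure_withDensity_ofReal (hhb n).2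
  have hκ : IsFiniteMeasure κ := isFiniteMeasure_withDensity_ofReal hν.2
  have hκ0 : κ {0} = 0 := by
    simp [κ, withDensity_apply _ (measurableSet_singleton (0 : E)), hh]
  have hchar : ∀ η, Tendsto (fun n => charFun (κs n) η) atTop (𝓝 (charFun κ η)) := fun η => by
    have hlim := (tendsto_integral_cosDefect_mul_cos hν hcos hp hexp η).comp hvlim
    have hcast := (Complex.continuous_ofReal.tendsto _).comp hlim
    rw [charFun_withDensity_of_symm hνsym hν hc.measurable h0 (cosDefect_neg m)]
    refine hcast.congr fun n => ?_
    rw [charFun_withDensity_of_symm (hpsym _ (hvpos n).le) (hhb n) (hwm n) (hw0 n)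
      (fun x => by simp [hh])]
    simp only [Function.comp_apply, ← integral_const_mul, mul_assoc, hh]
  have hmain := tendsto_integral_of_tendsto_charFun_of_continuousAt hchar hκ0
    (hf.measurable.div hc.measurable)
    (fun x hx => hf.continuousAt.div hc.continuousAt (hpos x hx).ne') hφb
  have hκf : ∫ x, f x / h x ∂κ = ∫ x, f x ∂ν := by
    rw [hwd hc.measurable h0]
    simp only [mul_comm (h _), hf0]
  have hκsf : ∀ n, ∫ x, f x / h x ∂(κs n) = (v n)⁻¹ * ∫ x, f x ∂(p (v n)) := fun n => by
    rw [hwd (hwm n) (hw0 n), ← integral_const_mul]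
    simp only [mul_assoc, mul_comm (h _), hf0]
  simp only [Pi.div_apply, hκf, hκsf] at hmain
  exact hmain

lemma map_neg_eq_of_char_real {P : Measure E} [IsFiniteMeasure P] {c : E → ℝ}
    (hP : ∀ ξ, ∫ x, Complex.exp (Complex.I * (⟪ξ, x⟫ : ℂ)) ∂P = c ξ) :
    P.map (fun x => -x) = P := by
  have hchar : ∀ ξ, charFun P ξ = c ξ := fun ξ => by
    rw [← hP, charFun_apply]
    simp_rw [mul_comm Complex.I, real_inner_comm ξ]
  refine Measure.ext_of_charFun (funext fun ξ => ?_)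
  have h := charFun_map_smul (μ := P) (-1) ξ
  simp only [neg_smul, one_smul] at h
  rw [h, charFun_neg, hchar, Complex.conj_ofReal]

end SmallTime

section Levy

lemma one_sub_cos_inner_le {E : Type*} [NormedAddCommGroup E] [InnerProductSpace ℝ E]
    (ξ y : E) :
    1 - Real.cos ⟪ξ, y⟫ ≤ (2 + ‖ξ‖ ^ 2) * min 1 (‖y‖ ^ 2) := by
  have hsq := sq_nonneg ‖ξ‖
  rcases le_total 1 (‖y‖ ^ 2) with h | h
  · rw [min_eq_left h]
    linarith [one_sub_cos_le_two ⟪ξ, y⟫]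
  · rw [min_eq_right h]
    have h1 := Real.one_sub_sq_div_two_le_cos (x := ⟪ξ, y⟫)
    have h2 : ⟪ξ, y⟫ ^ 2 ≤ ‖ξ‖ ^ 2 * ‖y‖ ^ 2 := by
      rw [← mul_pow, sq_le_sq, abs_of_nonneg (by positivity : 0 ≤ ‖ξ‖ * ‖y‖)]
      exact abs_real_inner_le_norm ξ y
    nlinarith [sq_nonneg ‖y‖, mul_nonneg hsq (sq_nonneg ‖y‖)]

lemma integrable_min_one_norm_sq {E : Type*} [NormedAddCommGroup E] [MeasurableSpace E]
    [BorelSpace E] {ν : Measure E}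
    (hν : ∫⁻ y, ENNReal.ofReal (min 1 (‖y‖ ^ 2)) ∂ν < ⊤) :
    Integrable (fun y => min 1 (‖y‖ ^ 2)) ν :=
  ⟨Continuous.aestronglyMeasurable (by fun_prop),
    (hasFiniteIntegral_iff_ofReal (ae_of_all _ fun y => le_min zero_le_one (by positivity))).2 hν⟩

lemma sigmaFinite_of_levy {E : Type*} [NormedAddCommGroup E] [MeasurableSpace E]
    [BorelSpace E] {ν : Measure E} (hν0 : ν {0} = 0)
    (hν : ∫⁻ y, ENNReal.ofReal (min 1 (‖y‖ ^ 2)) ∂ν < ⊤) : SigmaFinite ν := by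
  refine sigmaFinite_of_lintegral_lt_top (Measurable.ennreal_ofReal (by fun_prop)) hν
    (measure_mono_null (fun y hy => ?_) hν0)
  by_contra hne
  have : 0 < ‖y‖ := norm_pos_iff.2 hne
  exact (ENNReal.ofReal_pos.2 (lt_min zero_lt_one (by positivity))).ne' hy

variable {E : Type*} [NormedAddCommGroup E] [InnerProductSpace ℝ E] [MeasurableSpace E]
  [BorelSpace E]

lemma integrable_one_sub_cos_of_levy {ν : Measure E}
    (hν : ∫⁻ y, ENNReal.ofReal (min 1 (‖y‖ ^ 2)) ∂ν < ⊤) (ξ : E) :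
    Integrable (fun y => 1 - Real.cos ⟪ξ, y⟫) ν := by
  refine ((integrable_min_one_norm_sq hν).const_mul (2 + ‖ξ‖ ^ 2)).mono'
    (Continuous.aestronglyMeasurable (by fun_prop)) (ae_of_all _ fun y => ?_)
  rw [Real.norm_of_nonneg (one_sub_cos_nonneg _)]
  exact one_sub_cos_inner_le ξ y

lemma integrable_cosDefect_of_levy {ν m : Measure E} [IsFiniteMeasure m] {β K : ℝ}
    (hν : ∫⁻ y, ENNReal.ofReal (min 1 (‖y‖ ^ 2)) ∂ν < ⊤)
    (hνβ : ∫⁻ y in {y : E | ‖y‖ < 1}, ENNReal.ofReal (‖y‖ ^ β) ∂ν < ⊤)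
    (hK : ∀ x : E, ‖x‖ < 1 → cosDefect m x ≤ K * ‖x‖ ^ β) : Integrable (cosDefect m) ν := by
  have hs : MeasurableSet {y : E | ‖y‖ < 1} := measurableSet_lt (by fun_prop) (by fun_prop)
  have hm : ∀ P : Measure E, AEStronglyMeasurable (cosDefect m) P := fun P =>
    (continuous_cosDefect m).aestronglyMeasurable
  rw [← integrableOn_univ, ← Set.union_compl_self {y : E | ‖y‖ < 1}]
  refine IntegrableOn.union ?_ ?_
  · have hi : Integrable (fun y : E => ‖y‖ ^ β) (ν.restrict {y | ‖y‖ < 1}) :=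
      ⟨Measurable.aestronglyMeasurable (by fun_prop),
        (hasFiniteIntegral_iff_ofReal (ae_of_all _ fun y => by positivity)).2 hνβ⟩
    refine (hi.const_mul K).mono' (hm _) ((ae_restrict_iff' hs).2 (ae_of_all _ fun x hx => ?_))
    rw [Real.norm_of_nonneg (cosDefect_nonneg m x)]
    exact hK x hx
  · refine ((integrable_min_one_norm_sq hν).integrableOn.const_mul (2 * m.real Set.univ)).mono'
      (hm _) ((ae_restrict_iff' hs.compl).2 (ae_of_all _ fun x hx => ?_))
    have hx1 : 1 ≤ ‖x‖ := not_lt.1 hx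
    rw [Real.norm_of_nonneg (cosDefect_nonneg m x), min_eq_left (one_le_pow₀ hx1), mul_one]
    exact cosDefect_le m x

lemma cosDefect_eq_of_char_real {P : Measure E} [IsProbabilityMeasure P] {c : E → ℝ}
    (hP : ∀ ξ, ∫ x, Complex.exp (Complex.I * (⟪ξ, x⟫ : ℂ)) ∂P = c ξ) (ξ : E) :
    cosDefect P ξ = 1 - c ξ := by
  have hcos : Integrable (fun x => Real.cos ⟪ξ, x⟫) P :=
    Integrable.of_bound (Continuous.aestronglyMeasurable (by fun_prop)) 1
      (ae_of_all _ fun _ => Real.abs_cos_le_one _)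
  have hint : Integrable (fun x => Complex.exp (Complex.I * (⟪ξ, x⟫ : ℂ))) P :=
    Integrable.of_bound (Continuous.aestronglyMeasurable (by fun_prop)) 1
      (ae_of_all _ fun x => by rw [mul_comm]; exact (Complex.norm_exp_ofReal_mul_I _).le)
  have h := congrArg Complex.re (hP ξ)
  rw [← RCLike.re_eq_complex_re, ← integral_re hint] at h
  simp only [RCLike.re_eq_complex_re, mul_comm Complex.I, Complex.exp_ofReal_mul_I_re,
    Complex.ofReal_re] at h
  rw [cosDefect, integral_sub (integrable_const _) hcos, h]
  simp

end Levy

/-- Theorem 1, case 2(i) (1 ≤ β < 2, symmetric process):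
for a symmetric pure-jump Lévy process with triplet (0, 0, ν), symmetric Lévy
measure ν with ∫_{‖x‖<1} ‖x‖^β ν(dx) < ∞ and characteristic exponent
ψ(ξ) = ∫ (1 − cos⟨ξ,y⟩) ν(dy), if r = g ∗ μ̌ is bounded continuous and
|r(x) + r(−x) − 2r(0)| ≤ C‖x‖^β, then
t⁻¹(H_g^μ(t) − H_g^μ(0)) → (1/2)∫ (r(x) + r(−x) − 2r(0)) ν(dx) as t → 0+. -/
theorem heat_content_symmetric_finite_beta_variation
    (d : ℕ) (hd : 1 ≤ d) (β : ℝ) (hβ1 : 1 ≤ β) (hβ2 : β < 2)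
    -- ν is a symmetric Lévy measure
    (ν : Measure (EuclideanSpace ℝ (Fin d)))
    (hν0 : ν {0} = 0)
    (hνlevy : ∫⁻ y, ENNReal.ofReal (min 1 (‖y‖ ^ 2)) ∂ν < ⊤)
    (hνsym : ν.map (fun y => -y) = ν)
    (hνβ : ∫⁻ y in {y : EuclideanSpace ℝ (Fin d) | ‖y‖ < 1},
      ENNReal.ofReal (‖y‖ ^ β) ∂ν < ⊤)
    -- the (real) characteristic exponent
    (ψ : EuclideanSpace ℝ (Fin d) → ℝ)
    (hψ : ∀ ξ, ψ ξ = ∫ y, (1 - Real.cos ⟪ξ, y⟫) ∂ν)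
    -- (p t) are the marginal laws of the associated Lévy process
    (p : ℝ → Measure (EuclideanSpace ℝ (Fin d)))
    (hp : ∀ t, 0 ≤ t → IsProbabilityMeasure (p t))
    (hchar : ∀ t, 0 ≤ t → ∀ ξ,
      ∫ x, Complex.exp (Complex.I * (⟪ξ, x⟫ : ℂ)) ∂(p t)
        = Complex.exp (-(t * ψ ξ : ℝ)))
    -- g bounded Borel, μ a finite Borel measure
    (g : EuclideanSpace ℝ (Fin d) → ℝ) (hgm : Measurable g)
    (Cg : ℝ) (hgbd : ∀ x, |g x| ≤ Cg)
    (μ : Measure (EuclideanSpace ℝ (Fin d))) (hμ : IsFiniteMeasure μ)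
    -- r = g ∗ μ̌ is bounded and continuous
    (r : EuclideanSpace ℝ (Fin d) → ℝ)
    (hr : ∀ x, r x = ∫ y, g (x + y) ∂μ)
    (hrc : Continuous r) (Mr : ℝ) (hrbd : ∀ x, |r x| ≤ Mr)
    -- second-difference Hölder-type condition
    (C : ℝ) (hC : 0 < C)
    (hrH : ∀ x : EuclideanSpace ℝ (Fin d), |r x + r (-x) - 2 * r 0| ≤ C * ‖x‖ ^ β) :
    Integrable (fun x => r x + r (-x) - 2 * r 0) ν ∧
      Tendsto (fun t : ℝ => t⁻¹ * ((∫ y, r y ∂(p t)) - r 0)) (𝓝[>] 0)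
        (𝓝 ((1 / 2) * ∫ x, (r x + r (-x) - 2 * r 0) ∂ν)) := by
  have hβ0 : 0 < β := by linarith
  let m := gaussianMixture (EuclideanSpace ℝ (Fin d)) β
  have hm : IsFiniteMeasure m := isFiniteMeasure_gaussianMixture hβ0
  obtain ⟨c, K, hc, -, hball, hout⟩ :=
    cosDefect_gaussianMixture_bounds (E := EuclideanSpace ℝ (Fin d)) hβ0 hβ2
  have hνσ : SigmaFinite ν := sigmaFinite_of_levy hν0 hνlevy
  have hν : Integrable (cosDefect m) ν :=
    integrable_cosDefect_of_levy hνlevy hνβ fun x hx => (hball x hx).2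
  have hMr : 0 ≤ Mr := (abs_nonneg _).trans (hrbd 0)
  set f : EuclideanSpace ℝ (Fin d) → ℝ := fun x => r x + r (-x) - 2 * r 0 with hf
  have hfc : Continuous f := by fun_prop
  have hfK : ∀ x, |f x| ≤ (C + 4 * Mr) / c * cosDefect m x := fun x => by
    rw [div_mul_eq_mul_div, le_div_iff₀ hc]
    rcases lt_or_ge ‖x‖ 1 with hx | hx
    · calc |f x| * c ≤ C * ‖x‖ ^ β * c := by gcongr; exact hrH x
        _ = C * (c * ‖x‖ ^ β) := by ring
        _ ≤ (C + 4 * Mr) * cosDefect m x :=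
            mul_le_mul (by linarith) (hball x hx).1 (by positivity) (by positivity)
    · have h4 : |f x| ≤ 4 * Mr := by
        have h1 := abs_le.1 (hrbd x)
        have h2 := abs_le.1 (hrbd (-x))
        have h3 := abs_le.1 (hrbd 0)
        rw [abs_le]
        constructor <;> simp only [hf] <;> linarith
      exact mul_le_mul (by linarith) (hout x hx) hc.le (by positivity)
  have hpos : ∀ x, x ≠ 0 → 0 < cosDefect m x := fun x hx => by
    rcases lt_or_ge ‖x‖ 1 with h | h
    · have : 0 < ‖x‖ := norm_pos_iff.2 hx
      exact lt_of_lt_of_le (by positivity) (hball x h).1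
    · exact hc.trans_le (hout x h)
  refine ⟨(hν.const_mul _).mono' hfc.aestronglyMeasurable (ae_of_all _ hfK), ?_⟩
  have hψν : ∀ ξ, ψ ξ = cosDefect ν ξ := hψ
  have hchar' : ∀ t, 0 ≤ t → ∀ ξ, ∫ x, Complex.exp (Complex.I * (⟪ξ, x⟫ : ℂ)) ∂(p t) =
      (Real.exp (-(t * cosDefect ν ξ)) : ℝ) := fun t ht ξ => by
    rw [hchar t ht, hψν]
    push_cast
    rfl
  have hpsym : ∀ t, 0 ≤ t → (p t).map (fun x => -x) = p t := fun t ht =>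
    have := hp t ht
    map_neg_eq_of_char_real (hchar' t ht)
  have hlim := tendsto_inv_mul_integral_of_le_cosDefect hν hνsym
    (integrable_one_sub_cos_of_levy hνlevy) hp hpsym
    (fun t ht ξ =>
      have := hp t ht
      cosDefect_eq_of_char_real (hchar' t ht) ξ) hpos hfc hfK
  refine (hlim.const_mul (1 / 2)).congr' ?_
  filter_upwards [self_mem_nhdsWithin] with t ht
  have ht0 : 0 ≤ t := le_of_lt ht
  have := hp t ht0
  have hri : Integrable r (p t) :=
    Integrable.of_bound hrc.aestronglyMeasurable Mr (ae_of_all _ hrbd)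
  have hrni : Integrable (fun x => r (-x)) (p t) :=
    Integrable.of_bound (Continuous.aestronglyMeasurable (by fun_prop)) Mr
      (ae_of_all _ fun x => hrbd (-x))
  have hfi : ∫ x, f x ∂(p t) = 2 * ((∫ x, r x ∂(p t)) - r 0) := by
    have hadd : Integrable (fun x => r x + r (-x)) (p t) := hri.add hrni
    simp only [hf]
    rw [integral_sub hadd (integrable_const _), integral_add hri hrni,
      integral_comp_neg_of_symm (hpsym t ht0) r]
    simp only [integral_const, probReal_univ, one_smul]
    ring
  rw [hfi]
  ring
end
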